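/- arXiv:2507.13887 — 4 statements merged into one kernel-verified Lean document; each statement's English description precedes it below -/
import Mathlib

section
/- For every bounded metric space X, the minimum spanning tree dimension equals the upper box-counting dimension: dim_MST(X) = the upper box-counting dimension of X. -/
open Filter Metric
open scoped ENNReal

/-- The weight of a graph `G` on a finite subset `S` of a metric space, where each edge
`{x, y}` contributes `dist x y ^ α`. -/
noncomputable def graphDistPowWeight {X : Type*} [MetricSpace X] (α : ℝ) (S : Finset X)
    (G : SimpleGraph S) : ℝ :=
  ∑ e ∈ G.edgeSet.toFinite.toFinset,
    Sym2.lift ⟨fun (x y : S) => dist (x : X) (y : X) ^ α, fun x y => by simp [dist_comm]⟩ e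

/-- The `α`-weight `E_α(S)` of a finite subset `S` of a metric space: the minimum over all
spanning trees of the complete graph on `S` of the sum of the `α`-th powers of the
edge lengths. -/
noncomputable def mstWeight {X : Type*} [MetricSpace X] (α : ℝ) (S : Finset X) : ℝ :=
  sInf {w : ℝ | ∃ G : SimpleGraph S, G.IsTree ∧ w = graphDistPowWeight α S G}

/-- The minimum spanning tree dimension of a metric space `X`, as an extended nonnegative
real: the infimum of all `α > 0` such that the `α`-weights of nonempty finite subsets of `X`
are uniformly bounded; it is `∞` if no such `α` exists. -/
noncomputable def dimMST (X : Type*) [MetricSpace X] : ℝ≥0∞ :=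
  sInf {a : ℝ≥0∞ | ∃ α : ℝ, 0 < α ∧ a = ENNReal.ofReal α ∧
    BddAbove {w : ℝ | ∃ S : Finset X, S.Nonempty ∧ w = mstWeight α S}}

/-- `coveringNumber X ε` is the minimal number of closed balls of radius `ε` needed to
cover `X` (with value `∞` if no finite cover exists). -/
noncomputable def coveringNumber (X : Type*) [MetricSpace X] (ε : ℝ) : ℕ∞ :=
  sInf {n : ℕ∞ | ∃ t : Finset X, (t.card : ℕ∞) = n ∧ ∀ x : X, ∃ c ∈ t, dist x c ≤ ε}

/-- The upper box-counting dimension of a metric space `X`: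
`limsup_{ε → 0⁺} log N(X, ε) / log (1/ε)`, as an extended nonnegative real. -/
noncomputable def upperBoxDim (X : Type*) [MetricSpace X] : ℝ≥0∞ :=
  limsup (fun ε : ℝ =>
      if coveringNumber X ε = ⊤ then (⊤ : ℝ≥0∞)
      else ENNReal.ofReal (Real.log ((coveringNumber X ε).toNat) / Real.log (1 / ε)))
    (nhdsWithin 0 (Set.Ioi 0))

theorem aux_weight_tree_nonempty {X : Type*} [MetricSpace X] (α : ℝ) (S : Finset X)
    (hS : S.Nonempty) : {w : ℝ | ∃ G : SimpleGraph S, G.IsTree ∧ w = graphDistPowWeight α S G}.Nonempty := by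
  have : Nonempty S := hS.to_subtype
  obtain ⟨T, -, hT⟩ := (SimpleGraph.connected_top (V := S)).exists_isTree_le
  exact ⟨_, T, hT, rfl⟩

theorem aux_term_nonneg {X : Type*} [MetricSpace X] (α : ℝ) (S : Finset X) (e : Sym2 S) :
    0 ≤ Sym2.lift ⟨fun (x y : S) => dist (x : X) (y : X) ^ α, fun x y => by simp [dist_comm]⟩ e := by
  induction e with
  | _ x y => simpa using Real.rpow_nonneg dist_nonneg _

theorem aux_weight_nonneg {X : Type*} [MetricSpace X] (α : ℝ) (S : Finset X)
    (G : SimpleGraph S) : 0 ≤ graphDistPowWeight α S G :=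
  Finset.sum_nonneg fun e _ => aux_term_nonneg α S e

open Classical in
theorem aux_mst_le {X : Type*} [MetricSpace X] (α : ℝ) (S : Finset X)
    (r : X) (hr : r ∈ S) (p : X → X) (f : X → ℕ)
    (h : ∀ a ∈ S, a ≠ r → p a ∈ S ∧ f (p a) < f a) :
    mstWeight α S ≤ ∑ a ∈ S with a ≠ r, dist a (p a) ^ α := by
  let R : S → S → Prop := fun a b => (a : X) ≠ r ∧ (b : X) = p a
  let G : SimpleGraph S := SimpleGraph.fromRel R
  have hreach : ∀ n : ℕ, ∀ a : S, f a = n → G.Reachable a ⟨r, hr⟩ := by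
    intro n
    induction n using Nat.strong_induction_on with
    | _ n ih =>
      intro a ha
      by_cases har : (a : X) = r
      · have : a = ⟨r, hr⟩ := Subtype.ext har
        rw [this]
      · obtain ⟨h1, h2⟩ := h a a.2 har
        have hadj : G.Adj a ⟨p a, h1⟩ := by
          rw [SimpleGraph.fromRel_adj]
          refine ⟨?_, Or.inl ⟨har, rfl⟩⟩
          intro he
          have : (a : X) = p a := congrArg Subtype.val he
          rw [← this] at h2
          exact lt_irrefl _ h2
        exact hadj.reachable.trans (ih _ (ha ▸ h2) ⟨p a, h1⟩ rfl)
  have hconn : G.Connected := by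
    have : Nonempty S := ⟨⟨r, hr⟩⟩
    exact ⟨fun a b => (hreach _ a rfl).trans (hreach _ b rfl).symm⟩
  obtain ⟨T, hTG, hT⟩ := hconn.exists_isTree_le
  have h1 : mstWeight α S ≤ graphDistPowWeight α S T := by
    refine csInf_le ⟨0, ?_⟩ ⟨T, hT, rfl⟩
    rintro w ⟨G, -, rfl⟩
    exact aux_weight_nonneg α S G
  refine h1.trans ?_
  let g : X → Sym2 S := fun a =>
    if ha : a ∈ S ∧ p a ∈ S then s(⟨a, ha.1⟩, ⟨p a, ha.2⟩) else s(⟨r, hr⟩, ⟨r, hr⟩)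
  have hsub : T.edgeSet.toFinite.toFinset ⊆ (S.filter (fun a => a ≠ r)).image g := by
    intro e he
    rw [Set.Finite.mem_toFinset] at he
    have he' := SimpleGraph.edgeSet_mono hTG he
    induction e with
    | _ x y =>
      rw [SimpleGraph.mem_edgeSet, SimpleGraph.fromRel_adj] at he'
      rw [Finset.mem_image]
      rcases he'.2 with ⟨h3, h4⟩ | ⟨h3, h4⟩
      · refine ⟨x, by simp [h3], ?_⟩
        have : (x : X) ∈ S ∧ p x ∈ S := ⟨x.2, h4 ▸ y.2⟩
        simp only [g, dif_pos this]
        congr 1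
        simp [← h4]
      · refine ⟨y, by simp [h3], ?_⟩
        have : (y : X) ∈ S ∧ p y ∈ S := ⟨y.2, h4 ▸ x.2⟩
        simp only [g, dif_pos this]
        rw [Sym2.eq_swap]
        congr 1
        simp [← h4]
  unfold graphDistPowWeight
  refine (Finset.sum_le_sum_of_subset_of_nonneg hsub fun e _ _ => aux_term_nonneg α S e).trans ?_
  refine (Finset.sum_image_le_of_nonneg fun e _ => aux_term_nonneg α S e).trans ?_
  refine Finset.sum_le_sum fun a ha => ?_
  rw [Finset.mem_filter] at ha
  have : a ∈ S ∧ p a ∈ S := ⟨ha.1, (h a ha.1 ha.2).1⟩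
  simp only [g, dif_pos this]
  simp

theorem aux_induct {X : Type*} [MetricSpace X] (α : ℝ) (b : ℕ → ℝ) (hb : ∀ n, 0 ≤ b n)
    (H : ∀ S : Finset X, 2 ≤ S.card → ∃ x ∈ S, ∃ y ∈ S, x ≠ y ∧ dist x y ^ α ≤ b S.card) :
    ∀ n : ℕ, ∀ S : Finset X, S.card = n → S.Nonempty → ∃ r ∈ S, ∃ (p : X → X) (f : X → ℕ),
      (∀ a ∈ S, a ≠ r → p a ∈ S ∧ f (p a) < f a) ∧
      ∑ᶠ a ∈ {a | a ∈ S ∧ a ≠ r}, dist a (p a) ^ α ≤ ∑ i ∈ Finset.range (n + 1), b i := by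
  classical
  intro n
  induction n with
  | zero =>
    intro S h0 hS
    simp at h0
    simp [h0] at hS
  | succ n ih =>
    intro S hn hS
    by_cases h2 : 2 ≤ S.card
    · obtain ⟨x, hx, y, hy, hxy, hd⟩ := H S h2
      have hyE : y ∈ S.erase x := Finset.mem_erase.2 ⟨hxy.symm, hy⟩
      obtain ⟨r, hr, p, f, hpf, hsum⟩ := ih (S.erase x)
        (by rw [Finset.card_erase_of_mem hx]; omega) ⟨y, hyE⟩
      have hrx : r ≠ x := (Finset.mem_erase.1 hr).1
      refine ⟨r, (Finset.mem_erase.1 hr).2, Function.update p x y, Function.update f x (f y + 1), ?_, ?_⟩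
      · intro a ha har
        by_cases hax : a = x
        · subst hax
          simp [hy, Function.update_of_ne hxy.symm]
        · have := hpf a (Finset.mem_erase.2 ⟨hax, ha⟩) har
          have h3 := Finset.mem_erase.1 this.1
          simp [Function.update_of_ne hax, Function.update_of_ne h3.1, h3.2, this.2]
      · have e1 : {a | a ∈ S ∧ a ≠ r} = insert x {a | a ∈ S.erase x ∧ a ≠ r} := by
          ext a
          simp only [Set.mem_ofPred_eq, Set.mem_insert_iff, Finset.mem_erase]
          by_cases hax : a = x
          · subst hax; simp [hx, hrx.symm]
          · simp [hax]
        rw [e1, finsum_mem_insert _ (by simp)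
          ((S.erase x).finite_toSet.subset (fun a ha => ha.1))]
        have e2 : ∑ᶠ a ∈ {a | a ∈ S.erase x ∧ a ≠ r}, dist a (Function.update p x y a) ^ α
            = ∑ᶠ a ∈ {a | a ∈ S.erase x ∧ a ≠ r}, dist a (p a) ^ α := by
          refine finsum_mem_congr rfl ?_
          intro a ha
          rw [Function.update_of_ne (Finset.mem_erase.1 ha.1).1]
        rw [e2, Finset.sum_range_succ]
        rw [hn] at hd
        simp only [Function.update_self]
        linarith
    · have h1 : S.card = 1 := by have := hS.card_pos; omega
      obtain ⟨r, rfl⟩ := Finset.card_eq_one.1 h1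
      refine ⟨r, by simp, id, fun _ => 0, ?_, ?_⟩
      · intro a ha har
        simp at ha
        exact absurd ha har
      · have : {a | a ∈ ({r} : Finset X) ∧ a ≠ r} = ∅ := by
          ext a; simp
        rw [this, finsum_mem_empty]
        exact Finset.sum_nonneg fun i _ => hb i

theorem aux_mst_le_sum {X : Type*} [MetricSpace X] (α : ℝ) (b : ℕ → ℝ) (hb : ∀ n, 0 ≤ b n)
    (H : ∀ S : Finset X, 2 ≤ S.card → ∃ x ∈ S, ∃ y ∈ S, x ≠ y ∧ dist x y ^ α ≤ b S.card)
    (S : Finset X) (hS : S.Nonempty) : mstWeight α S ≤ ∑ i ∈ Finset.range (S.card + 1), b i := by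
  classical
  obtain ⟨r, hr, p, f, hpf, hsum⟩ := aux_induct α b hb H _ S rfl hS
  refine (aux_mst_le α S r hr p f hpf).trans (le_trans (le_of_eq ?_) hsum)
  have : {a | a ∈ S ∧ a ≠ r} = ((S.filter (fun a => a ≠ r) : Finset X) : Set X) := by
    ext a; simp
  rw [this, finsum_mem_coe_finset]

theorem aux_sep_card {X : Type*} [MetricSpace X] (S t : Finset X) (ε : ℝ)
    (hS : ∀ x ∈ S, ∀ y ∈ S, x ≠ y → 2 * ε < dist x y)
    (ht : ∀ x : X, ∃ c ∈ t, dist x c ≤ ε) : S.card ≤ t.card := by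
  choose c hc hd using ht
  refine Finset.card_le_card_of_injOn c (fun x _ => hc x) ?_
  intro x hx y hy hxy
  by_contra hne
  have h1 := hS x hx y hy hne
  have h2 := dist_triangle_right x y (c x)
  have h3 := hd x
  have h4 := hd y
  rw [← hxy] at h4
  linarith

theorem aux_upper {X : Type*} [MetricSpace X] (D : ℝ) (hD : ∀ x y : X, dist x y ≤ D)
    (α β ε0 : ℝ) (hβ : 0 < β) (hαβ : β < α) (hε0 : 0 < ε0)
    (hcov : ∀ ε : ℝ, 0 < ε → ε ≤ ε0 → ∃ t : Finset X, (t.card : ℝ) ≤ ε ^ (-β) ∧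
      ∀ x : X, ∃ c ∈ t, dist x c ≤ ε) :
    BddAbove {w : ℝ | ∃ S : Finset X, S.Nonempty ∧ w = mstWeight α S} := by
  have hα : 0 < α := hβ.trans hαβ
  by_cases hne : Nonempty X
  swap
  · refine ⟨0, ?_⟩
    rintro w ⟨S, ⟨x, _⟩, _⟩
    exact absurd ⟨x⟩ hne
  obtain ⟨x0⟩ := hne
  have hD0 : 0 ≤ D := dist_nonneg.trans (hD x0 x0)
  let c : ℝ := min (1/3) (ε0 / (D + 1))
  have hc0 : 0 < c := lt_min (by norm_num) (by positivity)
  have hc1 : c ≤ 1/3 := min_le_left _ _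
  have hc2 : c ≤ ε0 / (D + 1) := min_le_right _ _
  let b : ℕ → ℝ := fun n => (c⁻¹) ^ α * (n : ℝ) ^ (-(α/β))
  have hb : ∀ n, 0 ≤ b n := fun n => by positivity
  have hbs : Summable b := by
    refine Summable.mul_left _ ?_
    rw [Real.summable_nat_rpow]
    have : 1 < α / β := by rwa [one_lt_div hβ]
    linarith
  refine ⟨∑' n, b n, ?_⟩
  rintro w ⟨S, hS, rfl⟩
  refine (aux_mst_le_sum α b hb ?_ S hS).trans (hbs.sum_le_tsum _ fun i _ => hb i)
  intro S hS2
  classical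
  have hoff : S.offDiag.Nonempty := by
    obtain ⟨x, hx, y, hy, hxy⟩ := Finset.one_lt_card.1 hS2
    exact ⟨(x, y), by simp [hx, hy, hxy]⟩
  obtain ⟨⟨x, y⟩, hm, hmin⟩ := Finset.exists_min_image S.offDiag (fun q => dist q.1 q.2) hoff
  rw [Finset.mem_offDiag] at hm
  refine ⟨x, hm.1, y, hm.2.1, hm.2.2, ?_⟩
  have hδ : 0 < dist x y := dist_pos.2 hm.2.2
  have hcδ : 0 < c * dist x y := mul_pos hc0 hδ
  obtain ⟨t, htc, ht⟩ := hcov (c * dist x y) hcδ (by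
    calc c * dist x y ≤ ε0 / (D + 1) * (D + 1) :=
          mul_le_mul hc2 ((hD x y).trans (by linarith)) hδ.le (by positivity)
      _ = ε0 := by field_simp)
  have hcard := aux_sep_card S t (c * dist x y) (by
    intro a ha b hb hab
    have := hmin (a, b) (by simp [ha, hb, hab])
    simp only at this
    nlinarith) ht
  have hn : (S.card : ℝ) ≤ (c * dist x y) ^ (-β) := le_trans (by exact_mod_cast hcard) htc
  have hn0 : (0 : ℝ) < S.card := by exact_mod_cast (by omega : 0 < S.card)
  have h5 : ((c * dist x y) ^ (-β)) ^ (-(α/β)) ≤ (S.card : ℝ) ^ (-(α/β)) :=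
    Real.rpow_le_rpow_of_nonpos hn0 hn (by have : 0 < α/β := by positivity
                                           linarith)
  rw [← Real.rpow_mul hcδ.le, show -β * -(α/β) = α by field_simp,
    Real.mul_rpow hc0.le hδ.le] at h5
  have hcα : 0 < c ^ α := by positivity
  change _ ≤ (c⁻¹) ^ α * (S.card : ℝ) ^ (-(α/β))
  rw [Real.inv_rpow hc0.le, inv_mul_eq_div, le_div_iff₀ hcα]
  linarith

theorem aux_cov_finset {X : Type*} [MetricSpace X] (ε : ℝ) (h : coveringNumber X ε ≠ ⊤) :
    ∃ t : Finset X, t.card = (coveringNumber X ε).toNat ∧ ∀ x : X, ∃ c ∈ t, dist x c ≤ ε := by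
  have hne : {n : ℕ∞ | ∃ t : Finset X, (t.card : ℕ∞) = n ∧ ∀ x : X, ∃ c ∈ t, dist x c ≤ ε}.Nonempty := by
    by_contra hE
    rw [Set.not_nonempty_iff_eq_empty] at hE
    apply h
    unfold _root_.coveringNumber
    rw [hE, sInf_empty]
  obtain ⟨t, ht, hc⟩ := csInf_mem hne
  refine ⟨t, ?_, hc⟩
  unfold _root_.coveringNumber
  rw [← ht]
  simp

theorem aux_lower {X : Type*} [MetricSpace X] (α M ε : ℝ) (hα : 0 < α) (hε : 0 < ε) (hM : 0 ≤ M)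
    (hb : ∀ S : Finset X, S.Nonempty → mstWeight α S ≤ M) :
    coveringNumber X ε ≠ ⊤ ∧ ((coveringNumber X ε).toNat : ℝ) ≤ 1 + M * ε ^ (-α) := by
  classical
  have key : ∀ S : Finset X, (∀ x ∈ S, ∀ y ∈ S, x ≠ y → ε < dist x y) →
      (S.card : ℝ) ≤ 1 + M * ε ^ (-α) := by
    intro S hS
    have hεα : 0 < ε ^ α := by positivity
    rcases S.eq_empty_or_nonempty with rfl | hne
    · simp; positivity
    have h1 : ((S.card : ℝ) - 1) * ε ^ α ≤ mstWeight α S := by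
      refine le_csInf (aux_weight_tree_nonempty α S hne) ?_
      rintro w ⟨G, hG, rfl⟩
      have hcard : G.edgeSet.toFinite.toFinset.card + 1 = S.card := by
        have := hG.card_edgeFinset
        rw [Fintype.card_coe] at this
        rw [← this]
        congr 2
        ext e; simp
      have : ((S.card : ℝ) - 1) = G.edgeSet.toFinite.toFinset.card := by
        rw [← hcard]; push_cast; ring
      rw [this, ← nsmul_eq_mul]
      refine Finset.card_nsmul_le_sum _ _ _ ?_
      intro e he
      rw [Set.Finite.mem_toFinset] at he
      induction e with
      | _ x y =>
        rw [SimpleGraph.mem_edgeSet] at he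
        simp only [Sym2.lift_mk]
        exact Real.rpow_le_rpow hε.le (hS x x.2 y y.2 (fun h => he.ne (Subtype.ext h))).le hα.le
    have h2 := h1.trans (hb S hne)
    rw [Real.rpow_neg hε.le, ← div_eq_mul_inv]
    rw [← le_div_iff₀ hεα] at h2
    linarith
  -- maximal separated set
  obtain ⟨N, hN⟩ := exists_nat_ge (1 + M * ε ^ (-α))
  let P : ℕ → Prop := fun n => ∃ S : Finset X, S.card = n ∧ ∀ x ∈ S, ∀ y ∈ S, x ≠ y → ε < dist x y
  have hP0 : P 0 := ⟨∅, by simp⟩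
  have hPN : P (Nat.findGreatest P N) := Nat.findGreatest_spec (Nat.zero_le _) hP0
  obtain ⟨S, hSc, hS⟩ := hPN
  have hcover : ∀ x : X, ∃ c ∈ S, dist x c ≤ ε := by
    intro x
    by_contra hcon
    push Not at hcon
    have hx : x ∉ S := fun h => by
      have := hcon x h
      rw [dist_self] at this
      linarith
    have hsep : ∀ a ∈ insert x S, ∀ b ∈ insert x S, a ≠ b → ε < dist a b := by
      intro a ha b hb hab
      rw [Finset.mem_insert] at ha hb
      rcases ha with rfl | ha <;> rcases hb with rfl | hb
      · exact absurd rfl hab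
      · exact hcon b hb
      · rw [dist_comm]; exact hcon a ha
      · exact hS a ha b hb hab
    have hle : (insert x S).card ≤ N := by exact_mod_cast (key _ hsep).trans hN
    have := Nat.le_findGreatest (P := P) hle ⟨_, rfl, hsep⟩
    rw [Finset.card_insert_of_notMem hx] at this
    omega
  have hle : coveringNumber X ε ≤ S.card := sInf_le ⟨S, rfl, hcover⟩
  refine ⟨ne_top_of_le_ne_top (ENat.natCast_ne_top _) hle, le_trans ?_ (key S hS)⟩
  have := ENat.toNat_le_toNat hle (ENat.natCast_ne_top _)
  rw [ENat.toNat_natCast] at this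
  exact_mod_cast this

theorem aux_box_le {X : Type*} [MetricSpace X] (α : ℝ) (hα : 0 < α)
    (hb : BddAbove {w : ℝ | ∃ S : Finset X, S.Nonempty ∧ w = mstWeight α S}) :
    upperBoxDim X ≤ ENNReal.ofReal α := by
  obtain ⟨M', hM'⟩ := hb
  let M := max M' 0
  have hM : 0 ≤ M := le_max_right _ _
  have hb : ∀ S : Finset X, S.Nonempty → mstWeight α S ≤ M :=
    fun S hS => (hM' ⟨S, hS, rfl⟩).trans (le_max_left _ _)
  have hlog : Tendsto (fun ε : ℝ => Real.log (1 / ε)) (nhdsWithin 0 (Set.Ioi 0)) atTop := by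
    simp only [one_div]
    exact Real.tendsto_log_atTop.comp tendsto_inv_nhdsGT_zero
  have hlim : Tendsto (fun ε : ℝ => ENNReal.ofReal (Real.log (1 + M) / Real.log (1 / ε) + α))
      (nhdsWithin 0 (Set.Ioi 0)) (nhds (ENNReal.ofReal α)) := by
    refine ENNReal.tendsto_ofReal ?_
    simpa using (hlog.const_div_atTop (Real.log (1 + M))).add_const α
  rw [← hlim.limsup_eq]
  refine limsup_le_limsup ?_
  have hmem : Set.Ioo (0:ℝ) 1 ∈ nhdsWithin (0:ℝ) (Set.Ioi 0) := Ioo_mem_nhdsGT one_pos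
  filter_upwards [hmem] with ε hε
  obtain ⟨h1, h2⟩ := aux_lower α M ε hα hε.1 hM hb
  rw [if_neg h1]
  refine ENNReal.ofReal_le_ofReal ?_
  have hl : 0 < Real.log (1 / ε) := Real.log_pos (by rw [lt_div_iff₀ hε.1]; linarith [hε.2])
  have h3 : Real.log ((coveringNumber X ε).toNat) ≤ Real.log (1 + M) + α * Real.log (1 / ε) := by
    rcases Nat.eq_zero_or_pos (coveringNumber X ε).toNat with h0 | h0
    · rw [h0]
      simp only [Nat.cast_zero, Real.log_zero]
      have := Real.log_nonneg (by linarith : (1:ℝ) ≤ 1 + M)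
      positivity
    · have hpos : (0:ℝ) < (coveringNumber X ε).toNat := by exact_mod_cast h0
      have h4 : (1:ℝ) ≤ ε ^ (-α) := Real.one_le_rpow_of_pos_of_le_one_of_nonpos hε.1 hε.2.le (by linarith)
      have h5 : ((coveringNumber X ε).toNat : ℝ) ≤ (1 + M) * ε ^ (-α) := by linarith
      have h6 := Real.log_le_log hpos h5
      rw [Real.log_mul (by positivity) (by positivity), Real.log_rpow hε.1] at h6
      rw [one_div, Real.log_inv]
      linarith
  rw [div_add' _ _ _ hl.ne']
  gcongr

theorem aux_cov_eventually {X : Type*} [MetricSpace X] (β : ℝ) (hβ : 0 < β)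
    (h : upperBoxDim X < ENNReal.ofReal β) :
    ∃ ε0 : ℝ, 0 < ε0 ∧ ∀ ε : ℝ, 0 < ε → ε ≤ ε0 → ∃ t : Finset X, (t.card : ℝ) ≤ ε ^ (-β) ∧
      ∀ x : X, ∃ c ∈ t, dist x c ≤ ε := by
  have h1 := eventually_lt_of_limsup_lt h
  have hmem : Set.Ioo (0:ℝ) 1 ∈ nhdsWithin (0:ℝ) (Set.Ioi 0) := Ioo_mem_nhdsGT one_pos
  have h2 := h1.and hmem
  obtain ⟨u, hu, hsub⟩ := (mem_nhdsGT_iff_exists_Ioc_subset).1 h2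
  refine ⟨u, hu, fun ε he1 he2 => ?_⟩
  obtain ⟨h3, h4⟩ := hsub ⟨he1, he2⟩
  by_cases hT : coveringNumber X ε = ⊤
  · rw [if_pos hT] at h3
    exact absurd h3 not_top_lt
  rw [if_neg hT, ENNReal.ofReal_lt_ofReal_iff hβ] at h3
  obtain ⟨t, ht, hc⟩ := aux_cov_finset ε hT
  refine ⟨t, ?_, hc⟩
  rw [ht]
  have hl : 0 < Real.log (1 / ε) := Real.log_pos (by rw [lt_div_iff₀ h4.1]; linarith [h4.2])
  rw [div_lt_iff₀ hl, one_div, Real.log_inv] at h3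
  rcases Nat.eq_zero_or_pos (coveringNumber X ε).toNat with h0 | h0
  · rw [h0]
    simp only [Nat.cast_zero]
    exact Real.rpow_nonneg he1.le _
  · have hpos : (0:ℝ) < (coveringNumber X ε).toNat := by exact_mod_cast h0
    rw [← Real.log_le_log_iff hpos (Real.rpow_pos_of_pos he1 _), Real.log_rpow he1]
    linarith

/-- **Kozma–Lotker–Stupp**: for every bounded metric space `X`, the minimum spanning tree
dimension of `X` equals the upper box-counting dimension of `X`. -/
theorem dimMST_eq_upperBoxDim (X : Type*) [MetricSpace X]
    (hX : Bornology.IsBounded (Set.univ : Set X)) :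
    dimMST X = upperBoxDim X := by
  apply le_antisymm
  · refine le_of_forall_gt_imp_ge_of_dense fun a ha => ?_
    obtain ⟨α, h1, h2⟩ := ENNReal.lt_iff_exists_nnreal_btwn.1 ha
    obtain ⟨β, h3, h4⟩ := ENNReal.lt_iff_exists_nnreal_btwn.1 h1
    have hβα : (β : ℝ) < α := by exact_mod_cast h4
    have hβ : (0:ℝ) < β := by
      have : (0 : ℝ≥0∞) < β := bot_le.trans_lt h3
      exact_mod_cast this
    obtain ⟨ε0, he, hcov⟩ := aux_cov_eventually (X := X) β hβ (by simpa using h3)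
    obtain ⟨D, hD⟩ := Metric.isBounded_iff.1 hX
    have := aux_upper D (fun x y => hD (Set.mem_univ x) (Set.mem_univ y)) α β ε0 hβ hβα he hcov
    refine le_trans (sInf_le ⟨α, hβ.trans hβα, rfl, this⟩) ?_
    simpa using h2.le
  · refine le_sInf ?_
    rintro a ⟨α, hα, rfl, hb⟩
    exact aux_box_le α hα hb
end

section
/- Let X ⊆ ℝ^N be a nonempty compact set. Then the magnitude function t ↦ |tX|, where tX = {t·x : x ∈ X}, is continuous on (0, ∞). -/
open Metric Filter
open scoped Classical

/-- The magnitude of a finite set `S` of points of `ℝ^N`: the sum of all entries of the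
inverse of the matrix `Z` with entries `Z_{ij} = exp (−‖x_i − x_j‖)` for `x_i, x_j ∈ S`. -/
noncomputable def finMagnitude {N : ℕ} (S : Finset (EuclideanSpace ℝ (Fin N))) : ℝ :=
  ∑ i : S, ∑ j : S,
    (Matrix.of fun a b : S =>
      Real.exp (-dist (a : EuclideanSpace ℝ (Fin N)) (b : EuclideanSpace ℝ (Fin N))))⁻¹ i j

/-- The magnitude of a compact subset `X ⊆ ℝ^N`: the supremum of the magnitudes of its
nonempty finite subsets. -/
noncomputable def magnitude {N : ℕ} (X : Set (EuclideanSpace ℝ (Fin N))) : ℝ :=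
  sSup {m : ℝ | ∃ S : Finset (EuclideanSpace ℝ (Fin N)),
    S.Nonempty ∧ ↑S ⊆ X ∧ m = finMagnitude S}

open MeasureTheory

lemma glasser_aux (a : ℝ) (ha : 0 < a) :
    IntegrableOn (fun y : ℝ => Real.exp (-(y - a / y) ^ 2)) (Set.Ioi 0) ∧
    ∫ y in Set.Ioi (0:ℝ), Real.exp (-(y - a / y) ^ 2) = √Real.pi / 2 := by
  have hder : ∀ y ∈ Set.Ioi (0:ℝ), HasDerivWithinAt (fun y : ℝ => y - a / y) (1 + a / y ^ 2)
      (Set.Ioi 0) y := by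
    intro y hy
    have hy' : y ≠ 0 := ne_of_gt hy
    have h := ((hasDerivAt_id y).sub ((hasDerivAt_inv hy').const_mul a)).hasDerivWithinAt
      (s := Set.Ioi 0)
    simp only [div_eq_mul_inv]
    exact h.congr_deriv (by ring)
  have hinj : Set.InjOn (fun y : ℝ => y - a / y) (Set.Ioi 0) := by
    intro x hx y hy h
    have hx' : 0 < x := hx
    have hy' : 0 < y := hy
    simp only at h
    field_simp at h
    have h2 : (x - y) * (x * y + a) = 0 := by linarith
    rcases mul_eq_zero.1 h2 with h3 | h3
    · linarith
    · have : 0 < x * y := mul_pos hx' hy'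
      linarith
  have himg : (fun y : ℝ => y - a / y) '' (Set.Ioi 0) = Set.univ := by
    apply Set.eq_univ_of_forall
    intro u
    have h1 : 0 < u ^ 2 + 4 * a := by positivity
    have h2 : |u| < √(u ^ 2 + 4 * a) := by
      rw [← Real.sqrt_sq_eq_abs]
      exact Real.sqrt_lt_sqrt (sq_nonneg u) (by linarith)
    have h3 : 0 < u + √(u ^ 2 + 4 * a) := by
      have := neg_abs_le u
      linarith
    refine ⟨(u + √(u ^ 2 + 4 * a)) / 2, by simpa using h3, ?_⟩
    have h4 : √(u ^ 2 + 4 * a) ^ 2 = u ^ 2 + 4 * a := Real.sq_sqrt h1.le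
    simp only
    generalize √(u ^ 2 + 4 * a) = w at *
    field_simp
    nlinarith
  have hI := integral_image_eq_integral_abs_deriv_smul measurableSet_Ioi hder hinj
    (fun u => Real.exp (-u ^ 2))
  have hInt := (integrableOn_image_iff_integrableOn_abs_deriv_smul measurableSet_Ioi hder hinj
    (fun u => Real.exp (-u ^ 2))).1 (by
      rw [himg, integrableOn_univ]
      simpa using integrable_exp_neg_mul_sq (b := 1) one_pos)
  rw [himg, setIntegral_univ] at hI
  have hg : ∫ x : ℝ, Real.exp (-x ^ 2) = √Real.pi := by simpa using integral_gaussian 1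
  rw [hg] at hI
  -- integrability
  have hI1 : IntegrableOn (fun y : ℝ => Real.exp (-(y - a / y) ^ 2)) (Set.Ioi 0) := by
    refine Integrable.mono' hInt ?_ ?_
    · apply Measurable.aestronglyMeasurable
      fun_prop
    · refine Eventually.of_forall fun y => ?_
      have : 1 ≤ |1 + a / y ^ 2| := by
        rw [abs_of_nonneg (by positivity)]
        have : 0 ≤ a / y ^ 2 := by positivity
        linarith
      rw [Real.norm_eq_abs, abs_of_pos (Real.exp_pos _), smul_eq_mul]
      have h := Real.exp_pos (-(y - a / y) ^ 2)
      nlinarith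
  refine ⟨hI1, ?_⟩
  have hder2 : ∀ y ∈ Set.Ioi (0:ℝ), HasDerivWithinAt (fun y : ℝ => a / y) (-(a / y ^ 2))
      (Set.Ioi 0) y := by
    intro y hy
    have hy' : y ≠ 0 := ne_of_gt hy
    have h := ((hasDerivAt_inv hy').const_mul a).hasDerivWithinAt (s := Set.Ioi 0)
    simp only [div_eq_mul_inv]
    exact h.congr_deriv (by ring)
  have hinj2 : Set.InjOn (fun y : ℝ => a / y) (Set.Ioi 0) := by
    intro x hx y hy h
    have hx' : 0 < x := hx
    have hy' : 0 < y := hy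
    simp only at h
    field_simp at h
    linarith
  have himg2 : (fun y : ℝ => a / y) '' (Set.Ioi 0) = Set.Ioi 0 := by
    ext u
    constructor
    · rintro ⟨y, hy, rfl⟩
      exact div_pos ha hy
    · intro hu
      have hu' : 0 < u := hu
      exact ⟨a / u, div_pos ha hu, by simp only; field_simp⟩
  have hJ := integral_image_eq_integral_abs_deriv_smul measurableSet_Ioi hder2 hinj2
    (fun y => Real.exp (-(y - a / y) ^ 2))
  rw [himg2] at hJ
  have hJ' : ∫ y in Set.Ioi (0:ℝ), Real.exp (-(y - a / y) ^ 2) =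
      ∫ y in Set.Ioi (0:ℝ), (|1 + a / y ^ 2| • Real.exp (-(y - a / y) ^ 2) -
        Real.exp (-(y - a / y) ^ 2)) := by
    rw [hJ]
    refine setIntegral_congr_fun measurableSet_Ioi fun y hy => ?_
    have hy' : 0 < y := hy
    simp only [smul_eq_mul, abs_neg]
    rw [abs_of_nonneg (by positivity), abs_of_nonneg (by positivity)]
    have : a / y - a / (a / y) = -(y - a / y) := by field_simp; ring
    rw [this, neg_sq]
    ring
  rw [integral_sub hInt hI1, ← hI] at hJ'
  linarith

lemma subord (r t : ℝ) (hr : 0 ≤ r) (ht : 0 < t) :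
    IntegrableOn (fun z : ℝ => Real.exp (-(t * z) ^ 2) * Real.exp (-(1 / (4 * z ^ 2)) * r ^ 2))
      (Set.Ioi 0) ∧
    Real.exp (-(t * r)) = t * (2 / √Real.pi * ∫ z in Set.Ioi (0:ℝ),
      Real.exp (-(t * z) ^ 2) * Real.exp (-(1 / (4 * z ^ 2)) * r ^ 2)) := by
  have hpi : 0 < √Real.pi := Real.sqrt_pos.2 Real.pi_pos
  constructor
  · have h0 : IntegrableOn (fun z : ℝ => Real.exp (-(t * z) ^ 2)) (Set.Ioi 0) := by
      have := (integrable_exp_neg_mul_sq (b := t ^ 2) (by positivity)).integrableOn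
        (s := Set.Ioi (0:ℝ))
      simpa [mul_pow] using this
    refine Integrable.mono' h0 ?_ ?_
    · apply Measurable.aestronglyMeasurable
      fun_prop
    · refine Eventually.of_forall fun z => ?_
      rw [Real.norm_eq_abs, abs_of_pos (by positivity)]
      have : Real.exp (-(1 / (4 * z ^ 2)) * r ^ 2) ≤ 1 := by
        rw [Real.exp_le_one_iff, neg_mul]
        exact neg_nonpos.2 (by positivity)
      exact mul_le_of_le_one_right (Real.exp_pos _).le this
  · rcases hr.eq_or_lt with rfl | hr
    · have := integral_gaussian_Ioi (t ^ 2)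
      have h2 : (fun z : ℝ => Real.exp (-(t * z) ^ 2) * Real.exp (-(1 / (4 * z ^ 2)) * 0 ^ 2)) =
        fun z => Real.exp (-t ^ 2 * z ^ 2) := by
        funext z
        simp [mul_pow]
      rw [h2, this, Real.sqrt_div Real.pi_pos.le, Real.sqrt_sq ht.le]
      simp only [mul_zero, neg_zero, Real.exp_zero]
      field_simp
    · obtain ⟨-, h⟩ := glasser_aux (t * r / 2) (by positivity)
      have h3 := integral_comp_mul_left_Ioi
        (fun y : ℝ => Real.exp (-(y - t * r / 2 / y) ^ 2)) 0 ht
      rw [mul_zero, h] at h3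
      have h4 : ∫ z in Set.Ioi (0:ℝ),
          Real.exp (-(t * z) ^ 2) * Real.exp (-(1 / (4 * z ^ 2)) * r ^ 2) =
          Real.exp (-(t * r)) * ∫ z in Set.Ioi (0:ℝ),
            Real.exp (-(t * z - t * r / 2 / (t * z)) ^ 2) := by
        rw [← integral_const_mul]
        refine setIntegral_congr_fun measurableSet_Ioi fun z hz => ?_
        have hz' : 0 < z := hz
        rw [← Real.exp_add, ← Real.exp_add]
        congr 1
        field_simp
        ring
      rw [h4, h3, smul_eq_mul]
      field_simp

section
variable {N : ℕ} {ι : Type*} [Fintype ι]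

lemma gauss_rep (p : ℝ) (hp : 0 < p) (w : EuclideanSpace ℝ (Fin N)) :
    Integrable (fun v : EuclideanSpace ℝ (Fin N) =>
      Real.exp (-(1 / (4 * p)) * ‖v‖ ^ 2) * Real.cos (inner ℝ w v)) ∧
    ∫ v : EuclideanSpace ℝ (Fin N),
      Real.exp (-(1 / (4 * p)) * ‖v‖ ^ 2) * Real.cos (inner ℝ w v) =
      (4 * Real.pi * p) ^ ((N:ℝ) / 2) * Real.exp (-p * ‖w‖ ^ 2) := by
  have hb : 0 < (((1 / (4 * p) : ℝ)) : ℂ).re := by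
    rw [Complex.ofReal_re]; positivity
  have hint := GaussianFourier.integrable_cexp_neg_mul_sq_norm_add hb Complex.I w
  have hI := GaussianFourier.integral_cexp_neg_mul_sq_norm_add hb Complex.I w
  have hre : ∀ v : EuclideanSpace ℝ (Fin N),
      (Complex.exp (-((1 / (4 * p) : ℝ) : ℂ) * (‖v‖ : ℂ) ^ 2 +
        Complex.I * ((inner ℝ w v : ℝ) : ℂ))).re =
      Real.exp (-(1 / (4 * p)) * ‖v‖ ^ 2) * Real.cos (inner ℝ w v) := by
    intro v
    rw [Complex.exp_re]
    have h1 : -((1 / (4 * p) : ℝ) : ℂ) * (‖v‖ : ℂ) ^ 2 + Complex.I * ((inner ℝ w v : ℝ) : ℂ) =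
      ((-(1 / (4 * p)) * ‖v‖ ^ 2 : ℝ) : ℂ) + ((inner ℝ w v : ℝ) : ℂ) * Complex.I := by
      push_cast; ring
    rw [h1, Complex.add_re, Complex.add_im, Complex.re_ofReal_mul, Complex.im_ofReal_mul,
      Complex.ofReal_re, Complex.ofReal_im, Complex.I_re, Complex.I_im, mul_zero, mul_one,
      add_zero, zero_add]
  constructor
  · have := hint.re
    refine this.congr (Eventually.of_forall fun v => ?_)
    exact hre v
  · have h2 := integral_re hint
    have h3 : ∫ v : EuclideanSpace ℝ (Fin N),
      Real.exp (-(1 / (4 * p)) * ‖v‖ ^ 2) * Real.cos (inner ℝ w v) =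
      (∫ v : EuclideanSpace ℝ (Fin N), Complex.exp (-((1 / (4 * p) : ℝ) : ℂ) * (‖v‖ : ℂ) ^ 2 +
        Complex.I * ((inner ℝ w v : ℝ) : ℂ))).re := by
      refine Eq.trans ?_ h2
      exact integral_congr_ae (Eventually.of_forall fun v => (hre v).symm)
    rw [h3, hI]
    have h5 : (((Real.pi : ℝ) : ℂ) / ((1 / (4 * p) : ℝ) : ℂ)) ^
        ((Module.finrank ℝ (EuclideanSpace ℝ (Fin N)) : ℂ) / 2) *
        Complex.exp (Complex.I ^ 2 * (‖w‖ : ℂ) ^ 2 / (4 * ((1 / (4 * p) : ℝ) : ℂ))) =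
        (((4 * Real.pi * p) ^ ((N:ℝ) / 2) * Real.exp (-p * ‖w‖ ^ 2) : ℝ) : ℂ) := by
      rw [Complex.ofReal_mul, Complex.ofReal_cpow (by positivity), Complex.ofReal_exp]
      have hp' : (p : ℂ) ≠ 0 := by exact_mod_cast hp.ne'
      congr 1
      · congr 1
        · push_cast
          field_simp
        · simp
      · congr 1
        push_cast
        rw [Complex.I_sq]
        field_simp
    rw [h5, Complex.ofReal_re]

lemma cos_form_nonneg (c θ : ι → ℝ) :
    0 ≤ ∑ i, ∑ j, c i * c j * Real.cos (θ i - θ j) := by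
  have : ∑ i, ∑ j, c i * c j * Real.cos (θ i - θ j) =
      (∑ i, c i * Real.cos (θ i)) ^ 2 + (∑ i, c i * Real.sin (θ i)) ^ 2 := by
    simp only [sq, Finset.sum_mul_sum, ← Finset.sum_add_distrib, Real.cos_sub]
    refine Finset.sum_congr rfl fun i _ => Finset.sum_congr rfl fun j _ => ?_
    ring
  rw [this]
  positivity

/-- the Gaussian quadratic form -/
noncomputable def gForm (x : ι → EuclideanSpace ℝ (Fin N)) (c : ι → ℝ) (p : ℝ) : ℝ :=
  ∑ i, ∑ j, c i * c j * Real.exp (-p * dist (x i) (x j) ^ 2)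

/-- the exponential quadratic form -/
noncomputable def eForm (x : ι → EuclideanSpace ℝ (Fin N)) (c : ι → ℝ) (t : ℝ) : ℝ :=
  ∑ i, ∑ j, c i * c j * Real.exp (-(t * dist (x i) (x j)))

lemma gForm_rep (x : ι → EuclideanSpace ℝ (Fin N)) (c : ι → ℝ) (p : ℝ) (hp : 0 < p) :
    Integrable (fun v : EuclideanSpace ℝ (Fin N) => Real.exp (-(1 / (4 * p)) * ‖v‖ ^ 2) *
      ∑ i, ∑ j, c i * c j * Real.cos (inner ℝ (x i) v - inner ℝ (x j) v)) ∧
    (4 * Real.pi * p) ^ ((N:ℝ) / 2) * gForm x c p = ∫ v : EuclideanSpace ℝ (Fin N),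
      Real.exp (-(1 / (4 * p)) * ‖v‖ ^ 2) *
      ∑ i, ∑ j, c i * c j * Real.cos (inner ℝ (x i) v - inner ℝ (x j) v) := by
  have h : (fun v : EuclideanSpace ℝ (Fin N) => Real.exp (-(1 / (4 * p)) * ‖v‖ ^ 2) *
      ∑ i, ∑ j, c i * c j * Real.cos (inner ℝ (x i) v - inner ℝ (x j) v)) =
      fun v => ∑ i, ∑ j, c i * c j * (Real.exp (-(1 / (4 * p)) * ‖v‖ ^ 2) *
        Real.cos (inner ℝ (x i - x j) v)) := by
    funext v
    simp only [Finset.mul_sum, inner_sub_left]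
    refine Finset.sum_congr rfl fun i _ => Finset.sum_congr rfl fun j _ => ?_
    ring
  have hi : ∀ i j, Integrable (fun v => c i * c j * (Real.exp (-(1 / (4 * p)) * ‖v‖ ^ 2) *
        Real.cos (inner ℝ (x i - x j) v))) := fun i j =>
    ((gauss_rep p hp (x i - x j)).1).const_mul _
  rw [h]
  refine ⟨integrable_finsetSum _ fun i _ => integrable_finsetSum _ fun j _ => hi i j, ?_⟩
  rw [integral_finsetSum _ fun i _ => integrable_finsetSum _ fun j _ => hi i j]
  unfold gForm
  rw [Finset.mul_sum]
  refine Finset.sum_congr rfl fun i _ => ?_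
  rw [integral_finsetSum _ fun j _ => hi i j, Finset.mul_sum]
  refine Finset.sum_congr rfl fun j _ => ?_
  rw [integral_const_mul, (gauss_rep p hp (x i - x j)).2, dist_eq_norm]
  ring

lemma gForm_nonneg (x : ι → EuclideanSpace ℝ (Fin N)) (c : ι → ℝ) (p : ℝ) (hp : 0 < p) :
    0 ≤ gForm x c p := by
  have h := (gForm_rep x c p hp).2
  have h2 : 0 ≤ (4 * Real.pi * p) ^ ((N:ℝ) / 2) * gForm x c p := by
    rw [h]
    exact integral_nonneg fun v => mul_nonneg (Real.exp_pos _).le (cos_form_nonneg c _)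
  have h3 : 0 < (4 * Real.pi * p) ^ ((N:ℝ) / 2) := by positivity
  exact nonneg_of_mul_nonneg_right h2 h3

lemma gForm_mono (x : ι → EuclideanSpace ℝ (Fin N)) (c : ι → ℝ) (k s t : ℝ) (hk : 0 < k)
    (hs : 0 < s) (hst : s ≤ t) :
    s ^ N * gForm x c (k * s ^ 2) ≤ t ^ N * gForm x c (k * t ^ 2) := by
  have ht : 0 < t := hs.trans_le hst
  have key : ∀ u : ℝ, 0 < u → (4 * Real.pi * (k * u ^ 2)) ^ ((N:ℝ) / 2) =
      (4 * Real.pi * k) ^ ((N:ℝ) / 2) * u ^ N := by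
    intro u hu
    rw [← mul_assoc, Real.mul_rpow (by positivity) (by positivity)]
    congr 1
    rw [← Real.rpow_natCast u 2, ← Real.rpow_mul hu.le, ← Real.rpow_natCast u N]
    congr 1
    push_cast
    ring
  obtain ⟨hs1, hs2⟩ := gForm_rep x c (k * s ^ 2) (by positivity)
  obtain ⟨ht1, ht2⟩ := gForm_rep x c (k * t ^ 2) (by positivity)
  have h := integral_mono hs1 ht1 (by
    intro v
    refine mul_le_mul_of_nonneg_right ?_ (cos_form_nonneg c _)
    rw [Real.exp_le_exp, neg_mul, neg_mul, neg_le_neg_iff]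
    gcongr)
  rw [← hs2, ← ht2, key s hs, key t ht, mul_assoc (_ ^ _) (s ^ N), mul_assoc (_ ^ _) (t ^ N)] at h
  exact le_of_mul_le_mul_left h (by positivity)

lemma eForm_rep (x : ι → EuclideanSpace ℝ (Fin N)) (c : ι → ℝ) (t : ℝ) (ht : 0 < t) :
    IntegrableOn (fun z : ℝ => Real.exp (-(t * z) ^ 2) * gForm x c (1 / (4 * z ^ 2)))
      (Set.Ioi 0) ∧
    eForm x c t = t * (2 / √Real.pi * ∫ z in Set.Ioi (0:ℝ),
      Real.exp (-(t * z) ^ 2) * gForm x c (1 / (4 * z ^ 2))) := by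
  have h : (fun z : ℝ => Real.exp (-(t * z) ^ 2) * gForm x c (1 / (4 * z ^ 2))) =
      fun z => ∑ i, ∑ j, c i * c j * (Real.exp (-(t * z) ^ 2) *
        Real.exp (-(1 / (4 * z ^ 2)) * dist (x i) (x j) ^ 2)) := by
    funext z
    simp only [gForm, Finset.mul_sum]
    refine Finset.sum_congr rfl fun i _ => Finset.sum_congr rfl fun j _ => ?_
    ring
  have hi : ∀ i j, IntegrableOn (fun z => c i * c j * (Real.exp (-(t * z) ^ 2) *
        Real.exp (-(1 / (4 * z ^ 2)) * dist (x i) (x j) ^ 2))) (Set.Ioi 0) := fun i j =>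
    ((subord (dist (x i) (x j)) t dist_nonneg ht).1).const_mul _
  rw [h]
  refine ⟨integrable_finsetSum _ fun i _ => integrable_finsetSum _ fun j _ => hi i j, ?_⟩
  rw [integral_finsetSum _ fun i _ => integrable_finsetSum _ fun j _ => hi i j]
  unfold eForm
  rw [Finset.mul_sum, Finset.mul_sum]
  refine Finset.sum_congr rfl fun i _ => ?_
  rw [integral_finsetSum _ fun j _ => hi i j, Finset.mul_sum, Finset.mul_sum]
  refine Finset.sum_congr rfl fun j _ => ?_
  rw [integral_const_mul, (subord (dist (x i) (x j)) t dist_nonneg ht).2]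
  ring

lemma eForm_nonneg (x : ι → EuclideanSpace ℝ (Fin N)) (c : ι → ℝ) (t : ℝ) (ht : 0 < t) :
    0 ≤ eForm x c t := by
  rw [(eForm_rep x c t ht).2]
  have : 0 ≤ ∫ z in Set.Ioi (0:ℝ), Real.exp (-(t * z) ^ 2) * gForm x c (1 / (4 * z ^ 2)) := by
    refine setIntegral_nonneg measurableSet_Ioi fun z hz => ?_
    have hz' : 0 < z := hz
    exact mul_nonneg (Real.exp_pos _).le (gForm_nonneg x c _ (by positivity))
  positivity

lemma eForm_anti (x : ι → EuclideanSpace ℝ (Fin N)) (c : ι → ℝ) (s t : ℝ) (hs : 0 < s)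
    (hst : s ≤ t) : eForm x c t ≤ (t / s) * eForm x c s := by
  have ht : 0 < t := hs.trans_le hst
  obtain ⟨hs1, hs2⟩ := eForm_rep x c s hs
  obtain ⟨ht1, ht2⟩ := eForm_rep x c t ht
  have h := setIntegral_mono_on ht1 hs1 measurableSet_Ioi (by
    intro z hz
    have hz' : 0 < z := hz
    refine mul_le_mul_of_nonneg_right ?_ (gForm_nonneg x c _ (by positivity))
    rw [Real.exp_le_exp, neg_le_neg_iff]
    gcongr)
  rw [hs2, ht2, ← mul_assoc (t / s), div_mul_cancel₀ _ hs.ne']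
  gcongr

lemma eForm_rep2 (x : ι → EuclideanSpace ℝ (Fin N)) (c : ι → ℝ) (t : ℝ) (ht : 0 < t) :
    IntegrableOn (fun z : ℝ => Real.exp (-z ^ 2) * gForm x c (1 / (4 * z ^ 2) * t ^ 2))
      (Set.Ioi 0) ∧
    eForm x c t = 2 / √Real.pi * ∫ z in Set.Ioi (0:ℝ),
      Real.exp (-z ^ 2) * gForm x c (1 / (4 * z ^ 2) * t ^ 2) := by
  have h1 := eForm_rep (fun i => t • x i) c 1 one_pos
  have hd : ∀ i j, dist (t • x i) (t • x j) = t * dist (x i) (x j) := fun i j => by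
    rw [dist_smul₀, Real.norm_eq_abs, abs_of_pos ht]
  have hg : ∀ p, gForm (fun i => t • x i) c p = gForm x c (p * t ^ 2) := by
    intro p
    simp only [gForm, hd]
    refine Finset.sum_congr rfl fun i _ => Finset.sum_congr rfl fun j _ => ?_
    congr 2
    ring
  have he : eForm (fun i => t • x i) c 1 = eForm x c t := by
    simp only [eForm, hd, one_mul]
  simpa only [hg, he, one_mul] using h1

lemma eForm_mono (x : ι → EuclideanSpace ℝ (Fin N)) (c : ι → ℝ) (s t : ℝ) (hs : 0 < s)
    (hst : s ≤ t) : eForm x c s ≤ (t / s) ^ N * eForm x c t := by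
  have ht : 0 < t := hs.trans_le hst
  obtain ⟨hs1, hs2⟩ := eForm_rep2 x c s hs
  obtain ⟨ht1, ht2⟩ := eForm_rep2 x c t ht
  have h := setIntegral_mono_on hs1 (ht1.const_mul ((t / s) ^ N)) measurableSet_Ioi (by
    intro z hz
    have hz' : 0 < z := hz
    have := gForm_mono x c (1 / (4 * z ^ 2)) s t (by positivity) hs hst
    have h2 : gForm x c (1 / (4 * z ^ 2) * s ^ 2) ≤
        (t / s) ^ N * gForm x c (1 / (4 * z ^ 2) * t ^ 2) := by
      rw [div_pow, div_mul_eq_mul_div (t ^ N), le_div_iff₀ (by positivity)]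
      linarith
    rw [mul_left_comm]
    exact mul_le_mul_of_nonneg_left h2 (Real.exp_pos _).le)
  rw [integral_const_mul] at h
  rw [hs2, ht2, mul_left_comm]
  gcongr

lemma eForm_le (x : ι → EuclideanSpace ℝ (Fin N)) (c : ι → ℝ) (s t : ℝ) (hs : 0 < s)
    (ht : 0 < t) : eForm x c s ≤ (max (s / t) (t / s)) ^ (N + 1) * eForm x c t := by
  have h0 := eForm_nonneg x c t ht
  rcases le_total s t with h | h
  · refine (eForm_mono x c s t hs h).trans (mul_le_mul_of_nonneg_right ?_ h0)
    have h1 : 1 ≤ t / s := (one_le_div hs).2 h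
    calc (t / s) ^ N ≤ (t / s) ^ (N + 1) := pow_le_pow_right₀ h1 (Nat.le_succ N)
      _ ≤ _ := by gcongr; exact le_max_right _ _
  · refine (eForm_anti x c t s ht h).trans (mul_le_mul_of_nonneg_right ?_ h0)
    have h1 : 1 ≤ s / t := (one_le_div ht).2 h
    calc (s / t) ≤ (s / t) ^ (N + 1) := le_self_pow₀ h1 (Nat.succ_ne_zero N)
      _ ≤ _ := by gcongr; exact le_max_left _ _
end

lemma matrix_compare {n : Type*} [Fintype n] [DecidableEq n] (A B : Matrix n n ℝ)
    (hA : A.PosSemidef) (hB : B.PosSemidef) (C D : ℝ) (hC : 0 < C)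
    (hAB : ∀ v : n → ℝ, v ⬝ᵥ A.mulVec v ≤ C * (v ⬝ᵥ B.mulVec v))
    (hBA : ∀ v : n → ℝ, v ⬝ᵥ B.mulVec v ≤ D * (v ⬝ᵥ A.mulVec v)) :
    0 ≤ ∑ i, ∑ j, A⁻¹ i j ∧ ∑ i, ∑ j, B⁻¹ i j ≤ C * ∑ i, ∑ j, A⁻¹ i j := by
  have hsum : ∀ M : Matrix n n ℝ, ∑ i, ∑ j, M i j = (1 : n → ℝ) ⬝ᵥ M.mulVec 1 := by
    intro M
    simp [dotProduct, Matrix.mulVec]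
  have hkerA : ∀ v : n → ℝ, A.mulVec v = 0 → B.mulVec v = 0 := by
    intro v hv
    have h1 := hBA v
    rw [hv, dotProduct_zero, mul_zero] at h1
    refine (hB.dotProduct_mulVec_zero_iff v).1 (le_antisymm ?_ ?_)
    · simpa using h1
    · exact hB.dotProduct_mulVec_nonneg v
  have hkerB : ∀ v : n → ℝ, B.mulVec v = 0 → A.mulVec v = 0 := by
    intro v hv
    have h1 := hAB v
    rw [hv, dotProduct_zero, mul_zero] at h1
    refine (hA.dotProduct_mulVec_zero_iff v).1 (le_antisymm ?_ ?_)
    · simpa using h1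
    · exact hA.dotProduct_mulVec_nonneg v
  by_cases hdet : A.det = 0
  · have hdetB : B.det = 0 := by
      obtain ⟨v, hv, hv2⟩ := Matrix.exists_mulVec_eq_zero_iff.2 hdet
      exact Matrix.exists_mulVec_eq_zero_iff.1 ⟨v, hv, hkerA v hv2⟩
    rw [Matrix.nonsing_inv_apply_not_isUnit A (by simp [hdet]),
      Matrix.nonsing_inv_apply_not_isUnit B (by simp [hdetB])]
    simp
  · have hdetB : B.det ≠ 0 := by
      intro h
      obtain ⟨v, hv, hv2⟩ := Matrix.exists_mulVec_eq_zero_iff.2 h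
      exact hdet (Matrix.exists_mulVec_eq_zero_iff.1 ⟨v, hv, hkerB v hv2⟩)
    have uA : IsUnit A.det := isUnit_iff_ne_zero.2 hdet
    have uB : IsUnit B.det := isUnit_iff_ne_zero.2 hdetB
    rw [hsum, hsum]
    set v := A⁻¹.mulVec 1 with hv
    set w := B⁻¹.mulVec 1 with hw
    have hAv : A.mulVec v = 1 := by
      rw [hv, Matrix.mulVec_mulVec, Matrix.mul_nonsing_inv A uA, Matrix.one_mulVec]
    have hBw : B.mulVec w = 1 := by
      rw [hw, Matrix.mulVec_mulVec, Matrix.mul_nonsing_inv B uB, Matrix.one_mulVec]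
    have hvAw : v ⬝ᵥ A.mulVec w = 1 ⬝ᵥ w := by
      have hT : A.transpose = A := by
        have := hA.1
        rwa [Matrix.IsHermitian, Matrix.conjTranspose_eq_transpose_of_trivial] at this
      rw [Matrix.dotProduct_mulVec, ← Matrix.mulVec_transpose, hT, hAv]
    constructor
    · have := hA.dotProduct_mulVec_nonneg v
      rw [hAv] at this
      rw [dotProduct_comm]
      simpa using this
    · have h := hA.dotProduct_mulVec_nonneg (C • v - w)
      have h2 := hAB w
      rw [hBw, dotProduct_comm w 1] at h2
      simp only [star_trivial, Matrix.mulVec_sub, Matrix.mulVec_smul, hAv, dotProduct_sub,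
        sub_dotProduct, smul_dotProduct, dotProduct_smul, hvAw, smul_eq_mul] at h
      rw [dotProduct_comm v 1, dotProduct_comm w 1] at h
      have h3 : 0 ≤ C * (C * (1 ⬝ᵥ v) - 1 ⬝ᵥ w) := by linarith
      have := nonneg_of_mul_nonneg_right h3 hC
      linarith

section
variable {N : ℕ}

/-- the similarity matrix of a scaled finite set -/
noncomputable def zMat (S : Finset (EuclideanSpace ℝ (Fin N))) (t : ℝ) : Matrix S S ℝ :=
  Matrix.of fun a b : S => Real.exp (-(t * dist (a : EuclideanSpace ℝ (Fin N)) b))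

lemma zMat_form (S : Finset (EuclideanSpace ℝ (Fin N))) (t : ℝ) (v : S → ℝ) :
    v ⬝ᵥ (zMat S t).mulVec v = eForm (fun a : S => (a : EuclideanSpace ℝ (Fin N))) v t := by
  simp only [dotProduct, Matrix.mulVec, zMat, eForm, Matrix.of_apply, Finset.mul_sum]
  refine Finset.sum_congr rfl fun i _ => Finset.sum_congr rfl fun j _ => ?_
  ring

lemma zMat_psd (S : Finset (EuclideanSpace ℝ (Fin N))) (t : ℝ) (ht : 0 < t) :
    (zMat S t).PosSemidef := by
  refine Matrix.PosSemidef.of_dotProduct_mulVec_nonneg ?_ ?_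
  · ext i j
    simp [zMat, dist_comm]
  · intro v
    rw [star_trivial, zMat_form]
    exact eForm_nonneg _ _ _ ht

lemma finMagnitude_scale (S : Finset (EuclideanSpace ℝ (Fin N))) (t : ℝ) (ht : 0 < t) :
    finMagnitude (S.image (fun x => t • x)) = ∑ i : S, ∑ j : S, (zMat S t)⁻¹ i j := by
  have hinj : Function.Injective (fun x : EuclideanSpace ℝ (Fin N) => t • x) :=
    smul_right_injective _ ht.ne'
  let f : S → (S.image (fun x : EuclideanSpace ℝ (Fin N) => t • x) : Finset _) :=
    fun a => ⟨t • (a : EuclideanSpace ℝ (Fin N)), Finset.mem_image_of_mem _ a.2⟩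
  have hf : Function.Bijective f := by
    constructor
    · intro a b h
      exact Subtype.ext (hinj (congrArg Subtype.val h))
    · rintro ⟨y, hy⟩
      obtain ⟨a, ha, rfl⟩ := Finset.mem_image.1 hy
      exact ⟨⟨a, ha⟩, rfl⟩
  let e := Equiv.ofBijective f hf
  unfold finMagnitude
  set M := (Matrix.of fun a b : (S.image (fun x : EuclideanSpace ℝ (Fin N) => t • x) : Finset _) =>
      Real.exp (-dist (a : EuclideanSpace ℝ (Fin N)) (b : EuclideanSpace ℝ (Fin N)))) with hM
  have hz : zMat S t = M.submatrix e e := by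
    ext a b
    simp only [zMat, hM, Matrix.submatrix_apply, Matrix.of_apply]
    change _ = Real.exp (-dist (t • (a : EuclideanSpace ℝ (Fin N))) (t • (b : EuclideanSpace ℝ (Fin N))))
    rw [dist_smul₀, Real.norm_eq_abs, abs_of_pos ht]
  rw [hz, Matrix.inv_submatrix_equiv, ← e.sum_comp]
  refine Finset.sum_congr rfl fun i _ => ?_
  rw [← e.sum_comp]
  rfl

lemma finMagnitude_compare (S : Finset (EuclideanSpace ℝ (Fin N))) (s t : ℝ) (hs : 0 < s)
    (ht : 0 < t) : 0 ≤ finMagnitude (S.image (fun x => s • x)) ∧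
    finMagnitude (S.image (fun x => t • x)) ≤
      (max (s / t) (t / s)) ^ (N + 1) * finMagnitude (S.image (fun x => s • x)) := by
  rw [finMagnitude_scale S s hs, finMagnitude_scale S t ht]
  have hpos : 0 < max (s / t) (t / s) := lt_max_of_lt_left (by positivity)
  refine matrix_compare _ _ (zMat_psd S s hs) (zMat_psd S t ht) _
    ((max (t / s) (s / t)) ^ (N + 1)) (by positivity) ?_ ?_
  · intro v
    rw [zMat_form, zMat_form]
    exact eForm_le _ _ _ _ hs ht
  · intro v
    rw [zMat_form, zMat_form]
    exact eForm_le _ _ _ _ ht hs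

lemma magnitude_scale (X : Set (EuclideanSpace ℝ (Fin N))) (t : ℝ) :
    magnitude ((fun x => t • x) '' X) =
      sSup ((fun S : Finset (EuclideanSpace ℝ (Fin N)) => finMagnitude (S.image (fun x => t • x)))
        '' {S | S.Nonempty ∧ (S : Set _) ⊆ X}) := by
  unfold magnitude
  congr 1
  ext m
  constructor
  · rintro ⟨S, hS, hSX, rfl⟩
    obtain ⟨T, hT, rfl⟩ := Finset.subset_set_image_iff.1 hSX
    exact ⟨T, ⟨by simpa using hS, hT⟩, rfl⟩
  · rintro ⟨T, ⟨hT, hTX⟩, rfl⟩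
    refine ⟨_, hT.image _, ?_, rfl⟩
    rw [Finset.coe_image]
    exact Set.image_mono hTX

lemma sSup_compare {α : Type*} (P : Set α) (hP : P.Nonempty) (f g : α → ℝ) (C D : ℝ)
    (hC : 0 ≤ C) (hD : 0 ≤ D)
    (h1 : ∀ a, g a ≤ C * f a) (h2 : ∀ a, f a ≤ D * g a) :
    sSup (g '' P) ≤ C * sSup (f '' P) := by
  by_cases hb : BddAbove (f '' P)
  · refine csSup_le (hP.image g) ?_
    rintro _ ⟨a, ha, rfl⟩
    exact (h1 a).trans (mul_le_mul_of_nonneg_left (le_csSup hb ⟨a, ha, rfl⟩) hC)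
  · have hb2 : ¬ BddAbove (g '' P) := by
      rintro ⟨M, hM⟩
      refine hb ⟨D * M, ?_⟩
      rintro _ ⟨a, ha, rfl⟩
      exact (h2 a).trans (mul_le_mul_of_nonneg_left (hM ⟨a, ha, rfl⟩) hD)
    rw [Real.sSup_of_not_bddAbove hb, Real.sSup_of_not_bddAbove hb2, mul_zero]

lemma magnitude_compare (X : Set (EuclideanSpace ℝ (Fin N))) (hX : X.Nonempty) (s t : ℝ)
    (hs : 0 < s) (ht : 0 < t) :
    magnitude ((fun x => t • x) '' X) ≤
      (max (s / t) (t / s)) ^ (N + 1) * magnitude ((fun x => s • x) '' X) := by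
  rw [magnitude_scale, magnitude_scale]
  have hpos : 0 < max (s / t) (t / s) := lt_max_of_lt_left (by positivity)
  have hpos2 : 0 < max (t / s) (s / t) := lt_max_of_lt_left (by positivity)
  refine sSup_compare _ ?_ _ _ _ ((max (t / s) (s / t)) ^ (N + 1)) (by positivity)
    (by positivity) (fun S => (finMagnitude_compare S s t hs ht).2)
    (fun S => (finMagnitude_compare S t s ht hs).2)
  obtain ⟨x, hx⟩ := hX
  exact ⟨{x}, Finset.singleton_nonempty x, by simpa using hx⟩
end

/-- **Meckes**: for a nonempty compact set `X ⊆ ℝ^N`, the magnitude function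
`t ↦ |tX|`, where `tX = {t • x : x ∈ X}`, is continuous on `(0, ∞)`. -/
theorem magnitude_continuousOn (N : ℕ) (X : Set (EuclideanSpace ℝ (Fin N)))
    (hXne : X.Nonempty) (hX : IsCompact X) :
    ContinuousOn (fun t : ℝ => magnitude ((fun x => t • x) '' X)) (Set.Ioi 0) := by
  intro s hs
  have hs' : 0 < s := hs
  refine ContinuousAt.continuousWithinAt ?_
  set M : ℝ → ℝ := fun t => magnitude ((fun x => t • x) '' X) with hM
  have hpos : ∀ᶠ t in nhds s, 0 < t := lt_mem_nhds hs'
  have hC : Tendsto (fun t : ℝ => (max (s / t) (t / s)) ^ (N + 1)) (nhds s) (nhds 1) := by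
    have h : ContinuousAt (fun t : ℝ => (max (s / t) (t / s)) ^ (N + 1)) s := by
      have h1 : ContinuousAt (fun t : ℝ => s / t) s :=
        continuousAt_const.div continuousAt_id hs'.ne'
      have h2 : ContinuousAt (fun t : ℝ => t / s) s := continuousAt_id.div_const s
      exact (h1.max h2).pow _
    have h2 := h.tendsto
    simpa [div_self hs'.ne'] using h2
  have hl : Tendsto (fun t : ℝ => M s / (max (s / t) (t / s)) ^ (N + 1)) (nhds s)
      (nhds (M s)) := by
    have h := (tendsto_const_nhds (x := M s)).div hC one_ne_zero
    rw [div_one] at h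
    exact h
  have hu : Tendsto (fun t : ℝ => (max (s / t) (t / s)) ^ (N + 1) * M s) (nhds s)
      (nhds (M s)) := by
    simpa using hC.mul_const (M s)
  refine tendsto_of_tendsto_of_tendsto_of_le_of_le' hl hu ?_ ?_
  · filter_upwards [hpos] with t ht
    have h0 : 0 < max (s / t) (t / s) := lt_max_of_lt_left (by positivity)
    rw [div_le_iff₀ (by positivity), mul_comm, max_comm]
    exact magnitude_compare X hXne t s ht hs'
  · filter_upwards [hpos] with t ht
    exact magnitude_compare X hXne s t hs' ht
end

section
/- Let X ⊆ ℝ^N be a nonempty compact set. Then the upper magnitude dimension of X equals the upper box-counting (Minkowski) dimension of X: limsup_{t→∞} log|tX| / log t = limsup_{ε→0⁺} log N(X,ε) / log(1/ε). -/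
open Metric Filter
open scoped Classical

/-- `setCoveringNumber X ε` is the minimal number of closed balls of radius `ε` (centred at
points of `X`) needed to cover `X`. -/
noncomputable def setCoveringNumber {E : Type*} [MetricSpace E] (X : Set E) (ε : ℝ) : ℕ :=
  sInf {n : ℕ | ∃ t : Finset E, ↑t ⊆ X ∧ t.card = n ∧ ∀ x ∈ X, ∃ c ∈ t, dist x c ≤ ε}


open MeasureTheory in
lemma aux_glasser {a : ℝ} (ha : 0 < a) :
    ∫ v in Set.Ioi (0:ℝ), Real.exp (-(v - a / v) ^ 2) = √Real.pi / 2 := by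
  have hint : IntegrableOn (fun v : ℝ => Real.exp (-(v - a / v) ^ 2)) (Set.Ioi 0) := by
    have h1 : Integrable (fun v : ℝ => Real.exp (2 * a) * Real.exp (-1 * v ^ 2)) :=
      (integrable_exp_neg_mul_sq one_pos).const_mul _
    refine h1.integrableOn.mono' ?_ ?_
    · apply Measurable.aestronglyMeasurable
      fun_prop
    · filter_upwards [self_mem_ae_restrict measurableSet_Ioi] with v hv
      have hv : 0 < v := hv
      rw [Real.norm_of_nonneg (Real.exp_pos _).le, ← Real.exp_add]
      apply Real.exp_le_exp.2
      have : (v - a / v) ^ 2 = v ^ 2 - 2 * a + (a / v) ^ 2 := by field_simp; ring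
      nlinarith [sq_nonneg (a / v)]
  have d1 : ∀ x ∈ Set.Ioi (0:ℝ), HasDerivWithinAt (fun v : ℝ => v - a / v) (1 + a / x ^ 2)
      (Set.Ioi 0) x := by
    intro x hx
    have hx : 0 < x := hx
    have := ((hasDerivAt_id x).sub ((hasDerivAt_inv hx.ne').const_mul a)).hasDerivWithinAt
      (s := Set.Ioi 0)
    exact this.congr_deriv (by ring)
  have m1 : StrictMonoOn (fun v : ℝ => v - a / v) (Set.Ioi 0) := by
    intro x hx y hy hxy
    have hx : 0 < x := hx
    have : a / y < a / x := by gcongr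
    simp only
    linarith
  have i1 : (fun v : ℝ => v - a / v) '' Set.Ioi 0 = Set.univ := by
    apply Set.eq_univ_of_forall
    intro y
    have hs : √(y ^ 2 + 4 * a) ^ 2 = y ^ 2 + 4 * a := Real.sq_sqrt (by positivity)
    have hy : |y| < √(y ^ 2 + 4 * a) := by
      rw [← Real.sqrt_sq_eq_abs]; apply Real.sqrt_lt_sqrt (by positivity); linarith
    have hp : 0 < y + √(y ^ 2 + 4 * a) := by linarith [neg_abs_le y]
    refine ⟨(y + √(y ^ 2 + 4 * a)) / 2, ?_, ?_⟩
    · simp only [Set.mem_Ioi]; linarith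
    · simp only
      field_simp
      nlinarith
  have e1 := integral_image_eq_integral_abs_deriv_smul measurableSet_Ioi d1 m1.injOn
    (fun x => Real.exp (-x ^ 2))
  have d2 : ∀ x ∈ Set.Ioi (0:ℝ), HasDerivWithinAt (fun v : ℝ => a / v) (- (a / x ^ 2))
      (Set.Ioi 0) x := by
    intro x hx
    have hx : 0 < x := hx
    have := ((hasDerivAt_inv hx.ne').const_mul a).hasDerivWithinAt
      (s := Set.Ioi 0)
    exact this.congr_deriv (by ring)
  have m2 : Set.InjOn (fun v : ℝ => a / v) (Set.Ioi 0) := by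
    intro x hx y hy hxy
    have hx : 0 < x := hx
    have hy : 0 < y := hy
    simp only at hxy
    field_simp at hxy
    exact hxy.symm
  have i2 : (fun v : ℝ => a / v) '' Set.Ioi 0 = Set.Ioi 0 := by
    ext y
    constructor
    · rintro ⟨x, hx, rfl⟩
      have hx : 0 < x := hx
      simp only [Set.mem_Ioi]; positivity
    · intro hy
      have hy : 0 < y := hy
      refine ⟨a / y, ?_, ?_⟩
      · simp only [Set.mem_Ioi]; positivity
      · simp only
        field_simp
  have e2 := integral_image_eq_integral_abs_deriv_smul measurableSet_Ioi d2 m2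
    (fun x => Real.exp (-(x - a / x) ^ 2))
  have i2' := integrableOn_image_iff_integrableOn_abs_deriv_smul measurableSet_Ioi d2 m2
    (fun x => Real.exp (-(x - a / x) ^ 2))
  rw [i2] at e2 i2'
  have hint2 := i2'.1 hint
  rw [i1] at e1
  have g := integral_gaussian 1
  simp only [neg_mul, one_mul, div_one] at g
  rw [setIntegral_univ, g] at e1
  have key : ∀ x ∈ Set.Ioi (0:ℝ), |1 + a / x ^ 2| • Real.exp (-(x - a / x) ^ 2) =
      Real.exp (-(x - a / x) ^ 2) + |-(a / x ^ 2)| • Real.exp (-(a / x - a / (a / x)) ^ 2) := by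
    intro x hx
    have hx : 0 < x := hx
    have h3 : a / (a / x) = x := by field_simp
    rw [h3, abs_neg, abs_of_pos (by positivity), abs_of_pos (by positivity)]
    have : (a / x - x) ^ 2 = (x - a / x) ^ 2 := by ring
    rw [this]; simp only [smul_eq_mul]; ring
  rw [setIntegral_congr_fun measurableSet_Ioi key, integral_add hint hint2, ← e2] at e1
  linarith

open MeasureTheory in
lemma aux_subord {r : ℝ} (hr : 0 ≤ r) :
    ∫ v in Set.Ioi (0:ℝ), (2 / √Real.pi) * (Real.exp (-v ^ 2) * Real.exp (-(r ^ 2 / (4 * v ^ 2))))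
      = Real.exp (-r) := by
  have hpi : √Real.pi ≠ 0 := by positivity
  rw [integral_const_mul]
  rcases hr.eq_or_lt with rfl | hr
  · have g := integral_gaussian_Ioi 1
    simp only [neg_mul, one_mul, div_one] at g
    simp [g, hpi]
  · have key : ∀ v ∈ Set.Ioi (0:ℝ), Real.exp (-v ^ 2) * Real.exp (-(r ^ 2 / (4 * v ^ 2))) =
      Real.exp (-r) * Real.exp (-(v - (r / 2) / v) ^ 2) := by
      intro v hv
      have hv : 0 < v := hv
      rw [← Real.exp_add, ← Real.exp_add]
      congr 1
      field_simp
      ring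
    rw [setIntegral_congr_fun measurableSet_Ioi key, integral_const_mul, aux_glasser (by positivity)]
    field_simp

open MeasureTheory FourierTransform in
lemma aux_gauss {V : Type*} [NormedAddCommGroup V] [InnerProductSpace ℝ V] [FiniteDimensional ℝ V]
    [MeasurableSpace V] [BorelSpace V] {v : ℝ} (hv : 0 < v) (x : V) :
    ∫ ξ : V, ((Real.fourierChar (-inner ℝ ξ x) : Circle) : ℂ) *
      (((2 * √Real.pi * v) ^ Module.finrank ℝ V * Real.exp (-(4 * Real.pi ^ 2 * v ^ 2) * ‖ξ‖ ^ 2) : ℝ) : ℂ)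
      = (Real.exp (-(‖x‖ ^ 2 / (4 * v ^ 2))) : ℝ) := by
  have hb : 0 < 4 * Real.pi ^ 2 * v ^ 2 := by positivity
  have := fourier_gaussian_innerProductSpace (b := ((4 * Real.pi ^ 2 * v ^ 2 : ℝ) : ℂ))
    (by rw [Complex.ofReal_re]; exact hb) x
  have hc : ((Real.pi : ℂ) / ((4 * Real.pi ^ 2 * v ^ 2 : ℝ) : ℂ)) ^ ((Module.finrank ℝ V : ℂ) / 2)
      = (((2 * √Real.pi * v) ^ Module.finrank ℝ V : ℝ) : ℂ)⁻¹ := by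
    have h1 : Real.pi / (4 * Real.pi ^ 2 * v ^ 2) = ((2 * √Real.pi * v)⁻¹) ^ (2:ℝ) := by
      rw [Real.rpow_two, inv_pow, mul_pow, mul_pow, Real.sq_sqrt Real.pi_pos.le]
      field_simp
      norm_num
    rw [← Complex.ofReal_div, ← Complex.ofReal_natCast, ← Complex.ofReal_ofNat,
      ← Complex.ofReal_div, ← Complex.ofReal_cpow (by positivity), h1,
      ← Real.rpow_mul (by positivity)]
    rw [mul_div_cancel₀ _ (by norm_num), Real.rpow_natCast, inv_pow, Complex.ofReal_inv]
  rw [hc, Real.fourier_eq] at this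
  have hk : (((2 * √Real.pi * v) ^ Module.finrank ℝ V : ℝ) : ℂ) ≠ 0 := by
    rw [Complex.ofReal_ne_zero]; positivity
  rw [eq_inv_mul_iff_mul_eq₀ hk, ← integral_const_mul] at this
  convert this using 1
  · congr 1; ext ξ
    simp only [Circle.smul_def, smul_eq_mul]
    push_cast
    ring_nf
  · push_cast
    congr 1
    have : (Real.pi : ℂ) ≠ 0 := by exact_mod_cast Real.pi_ne_zero
    have : (v : ℂ) ≠ 0 := by exact_mod_cast hv.ne'
    field_simp

/-- trigonometric polynomial -/
noncomputable def auxW {V ι : Type*} [NormedAddCommGroup V] [InnerProductSpace ℝ V] [Fintype ι]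
    (x : ι → V) (w : ι → ℝ) (ξ : V) : ℂ :=
  ∑ i, (w i : ℂ) * ((Real.fourierChar (-inner ℝ (x i) ξ) : Circle) : ℂ)

/-- Gaussian -/
noncomputable def auxG {V : Type*} [NormedAddCommGroup V] [InnerProductSpace ℝ V]
    (v : ℝ) (ξ : V) : ℝ :=
  (2 * √Real.pi * v) ^ Module.finrank ℝ V * Real.exp (-(4 * Real.pi ^ 2 * v ^ 2) * ‖ξ‖ ^ 2)

lemma auxW_norm_sq {V ι : Type*} [NormedAddCommGroup V] [InnerProductSpace ℝ V] [Fintype ι]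
    (x : ι → V) (w : ι → ℝ) (ξ : V) :
    ((‖auxW x w ξ‖ ^ 2 : ℝ) : ℂ) = ∑ i, ∑ j, ((w i * w j : ℝ) : ℂ) *
      ((Real.fourierChar (-inner ℝ ξ (x i - x j)) : Circle) : ℂ) := by
  rw [Complex.ofReal_pow, ← Complex.mul_conj', auxW, map_sum, Finset.sum_mul_sum]
  refine Finset.sum_congr rfl fun i _ => Finset.sum_congr rfl fun j _ => ?_
  rw [map_mul, Complex.conj_ofReal, ← Circle.coe_inv_eq_conj, ← AddChar.map_neg_eq_inv]
  have : -inner ℝ ξ (x i - x j) = -inner ℝ (x i) ξ + - -inner ℝ (x j) ξ := by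
    rw [inner_sub_right, real_inner_comm, real_inner_comm (x j)]; ring
  rw [this, AddChar.map_add_eq_mul, Circle.coe_mul]
  push_cast
  ring

lemma auxW_continuous {V ι : Type*} [NormedAddCommGroup V] [InnerProductSpace ℝ V] [Fintype ι]
    (x : ι → V) (w : ι → ℝ) : Continuous (auxW x w) := by
  unfold auxW
  refine continuous_finsetSum _ fun i _ => continuous_const.mul ?_
  exact continuous_induced_dom.comp (Real.continuous_fourierChar.comp (by fun_prop))

lemma auxW_norm_le {V ι : Type*} [NormedAddCommGroup V] [InnerProductSpace ℝ V] [Fintype ι]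
    (x : ι → V) (w : ι → ℝ) (ξ : V) : ‖auxW x w ξ‖ ≤ ∑ i, |w i| := by
  unfold auxW
  refine (norm_sum_le _ _).trans (Finset.sum_le_sum fun i _ => ?_)
  rw [norm_mul, Circle.norm_coe, mul_one]
  simp

section
open MeasureTheory
variable {V ι : Type*} [NormedAddCommGroup V] [InnerProductSpace ℝ V] [FiniteDimensional ℝ V]
    [MeasurableSpace V] [BorelSpace V] [Fintype ι]

lemma auxG_integrable {v : ℝ} (hv : 0 < v) : Integrable (auxG v : V → ℝ) := by
  unfold auxG
  apply Integrable.const_mul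
  have hb : 0 < 4 * Real.pi ^ 2 * v ^ 2 := by positivity
  have := (GaussianFourier.integrable_cexp_neg_mul_sq_norm_add
    (b := ((4 * Real.pi ^ 2 * v ^ 2 : ℝ) : ℂ)) (by rw [Complex.ofReal_re]; exact hb) 0 (0:V)).norm
  refine this.congr (ae_of_all _ fun ξ => ?_)
  simp only [Complex.norm_exp]
  congr 1
  simp [← Complex.ofReal_pow, ← Complex.ofReal_mul]

lemma auxWG_integrable (x : ι → V) (w : ι → ℝ) {v : ℝ} (hv : 0 < v) :
    Integrable (fun ξ => ‖auxW x w ξ‖ ^ 2 * auxG v ξ) := by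
  refine (auxG_integrable hv).bdd_mul (c := (∑ i, |w i|) ^ 2)
    ((auxW_continuous x w).norm.pow 2).aestronglyMeasurable (ae_of_all _ fun ξ => ?_)
  rw [norm_pow, norm_norm]
  gcongr
  exact auxW_norm_le x w ξ

lemma aux_quad_gauss (x : ι → V) (w : ι → ℝ) {v : ℝ} (hv : 0 < v) :
    ∫ ξ, ‖auxW x w ξ‖ ^ 2 * auxG v ξ =
      ∑ i, ∑ j, w i * w j * Real.exp (-(‖x i - x j‖ ^ 2 / (4 * v ^ 2))) := by
  apply Complex.ofReal_injective
  rw [← integral_complex_ofReal]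
  have hi : ∀ i j, Integrable (fun ξ : V => ((w i * w j : ℝ) : ℂ) *
      (((Real.fourierChar (-inner ℝ ξ (x i - x j)) : Circle) : ℂ) * (auxG v ξ : ℝ))) := by
    intro i j
    apply Integrable.const_mul
    refine ((auxG_integrable hv).ofReal).bdd_mul (c := 1) ?_ (ae_of_all _ fun ξ => (Circle.norm_coe _).le)
    apply Continuous.aestronglyMeasurable
    exact continuous_induced_dom.comp (Real.continuous_fourierChar.comp (by fun_prop))
  have : ∀ ξ, ((‖auxW x w ξ‖ ^ 2 * auxG v ξ : ℝ) : ℂ) = ∑ i, ∑ j, ((w i * w j : ℝ) : ℂ) *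
      (((Real.fourierChar (-inner ℝ ξ (x i - x j)) : Circle) : ℂ) * (auxG v ξ : ℝ)) := by
    intro ξ
    rw [Complex.ofReal_mul, auxW_norm_sq, Finset.sum_mul]
    simp only [Finset.sum_mul, mul_assoc]
  simp_rw [this]
  rw [integral_finsetSum _ fun i _ => integrable_finsetSum _ fun j _ => hi i j]
  rw [Complex.ofReal_sum]
  refine Finset.sum_congr rfl fun i _ => ?_
  rw [integral_finsetSum _ fun j _ => hi i j, Complex.ofReal_sum]
  refine Finset.sum_congr rfl fun j _ => ?_
  rw [integral_const_mul]
  unfold auxG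
  rw [aux_gauss hv, ← Complex.ofReal_mul]

/-- subordination for quadratic forms -/
lemma aux_quad_subord (x : ι → V) (w : ι → ℝ) :
    IntegrableOn (fun v => (2 / √Real.pi * Real.exp (-v ^ 2)) *
        ∫ ξ, ‖auxW x w ξ‖ ^ 2 * auxG v ξ) (Set.Ioi (0:ℝ)) ∧
    ∑ i, ∑ j, w i * w j * Real.exp (-dist (x i) (x j)) =
      ∫ v in Set.Ioi (0:ℝ), (2 / √Real.pi * Real.exp (-v ^ 2)) *
        ∫ ξ, ‖auxW x w ξ‖ ^ 2 * auxG v ξ := by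
  have hi : ∀ i j, IntegrableOn (fun v : ℝ => w i * w j * ((2 / √Real.pi) * (Real.exp (-v ^ 2) *
      Real.exp (-(‖x i - x j‖ ^ 2 / (4 * v ^ 2)))))) (Set.Ioi 0) := by
    intro i j
    apply Integrable.const_mul
    apply Integrable.const_mul
    have h1 : Integrable (fun v : ℝ => Real.exp (-1 * v ^ 2)) := integrable_exp_neg_mul_sq one_pos
    simp only [neg_mul, one_mul] at h1
    refine h1.integrableOn.mul_bdd (c := 1) ?_ (ae_of_all _ fun v => ?_)
    · apply Measurable.aestronglyMeasurable
      fun_prop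
    · rw [Real.norm_of_nonneg (Real.exp_pos _).le, Real.exp_le_one_iff, neg_nonpos]
      positivity
  have : ∀ v ∈ Set.Ioi (0:ℝ), (2 / √Real.pi * Real.exp (-v ^ 2)) *
        ∫ ξ, ‖auxW x w ξ‖ ^ 2 * auxG v ξ = ∑ i, ∑ j, w i * w j * ((2 / √Real.pi) *
        (Real.exp (-v ^ 2) * Real.exp (-(‖x i - x j‖ ^ 2 / (4 * v ^ 2))))) := by
    intro v hv
    rw [aux_quad_gauss x w hv, Finset.mul_sum]
    refine Finset.sum_congr rfl fun i _ => ?_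
    rw [Finset.mul_sum]
    refine Finset.sum_congr rfl fun j _ => ?_
    ring
  refine ⟨(integrableOn_congr_fun this measurableSet_Ioi).2
    (integrable_finsetSum _ fun i _ => integrable_finsetSum _ fun j _ => hi i j), ?_⟩
  rw [setIntegral_congr_fun measurableSet_Ioi this]
  rw [integral_finsetSum _ fun i _ => integrable_finsetSum _ fun j _ => hi i j]
  refine Finset.sum_congr rfl fun i _ => ?_
  rw [integral_finsetSum _ fun j _ => hi i j]
  refine Finset.sum_congr rfl fun j _ => ?_
  rw [integral_const_mul, aux_subord (norm_nonneg _), dist_eq_norm]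

end

section
open MeasureTheory FourierTransform SchwartzMap
variable {V : Type*} [NormedAddCommGroup V] [InnerProductSpace ℝ V] [FiniteDimensional ℝ V]
    [MeasurableSpace V] [BorelSpace V]

lemma auxG_nonneg {v : ℝ} (hv : 0 ≤ v) (ξ : V) : 0 ≤ auxG v ξ := by
  unfold auxG; positivity

lemma aux_lower_s11 : ∃ c : ℝ, 0 < c ∧ ∀ ξ : V,
    ENNReal.ofReal (c * ((1 + ‖ξ‖) ^ (Module.finrank ℝ V + 1))⁻¹) ≤
      ∫⁻ v in Set.Ioi (0:ℝ), ENNReal.ofReal (2 / √Real.pi * Real.exp (-v ^ 2) * auxG v ξ) := by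
  set n := Module.finrank ℝ V
  refine ⟨(2 / √Real.pi * Real.exp (-1) * Real.exp (-(4 * Real.pi ^ 2))) / 2, by positivity, ?_⟩
  intro ξ
  set T := 1 + ‖ξ‖ with hT
  have hT1 : 1 ≤ T := by rw [hT]; linarith [norm_nonneg ξ]
  have hT0 : 0 < T := by linarith
  set k := 2 / √Real.pi * Real.exp (-1) * Real.exp (-(4 * Real.pi ^ 2))
  calc ENNReal.ofReal (k / 2 * (T ^ (n + 1))⁻¹)
      = ∫⁻ v in Set.Icc (1 / (2 * T)) (1 / T), ENNReal.ofReal (k * (T ^ n)⁻¹) := by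
        rw [setLIntegral_const, Real.volume_Icc, ← ENNReal.ofReal_mul (by positivity)]
        congr 1
        field_simp
        ring
    _ ≤ ∫⁻ v in Set.Icc (1 / (2 * T)) (1 / T),
          ENNReal.ofReal (2 / √Real.pi * Real.exp (-v ^ 2) * auxG v ξ) := by
        apply setLIntegral_mono' measurableSet_Icc
        intro v hv
        apply ENNReal.ofReal_le_ofReal
        have hv0 : 0 < v := lt_of_lt_of_le (by positivity) hv.1
        have h1 : v * T ≤ 1 := by have := hv.2; rwa [le_div_iff₀ hT0] at this
        have hv1 : v ≤ 1 := by nlinarith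
        have h2 : v * ‖ξ‖ ≤ 1 := by nlinarith [norm_nonneg ξ]
        have e1 : Real.exp (-1) ≤ Real.exp (-v ^ 2) := by
          apply Real.exp_le_exp.2; nlinarith
        have e2 : Real.exp (-(4 * Real.pi ^ 2)) ≤
            Real.exp (-(4 * Real.pi ^ 2 * v ^ 2) * ‖ξ‖ ^ 2) := by
          apply Real.exp_le_exp.2
          have : (v * ‖ξ‖) ^ 2 ≤ 1 := pow_le_one₀ (by positivity) h2
          nlinarith [sq_nonneg Real.pi]
        have e3 : (T ^ n)⁻¹ ≤ (2 * √Real.pi * v) ^ n := by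
          rw [← inv_pow]
          apply pow_le_pow_left₀ (by positivity)
          have h3 : 1 / (2 * T) ≤ v := hv.1
          have h4 : (1:ℝ) ≤ √Real.pi := by
            rw [Real.one_le_sqrt]; linarith [Real.pi_gt_three]
          calc T⁻¹ = 2 * 1 * (1 / (2 * T)) := by field_simp
            _ ≤ _ := by gcongr
        unfold auxG
        calc k * (T ^ n)⁻¹ = 2 / √Real.pi * Real.exp (-1) *
              ((T ^ n)⁻¹ * Real.exp (-(4 * Real.pi ^ 2))) := by ring
          _ ≤ _ := by gcongr
    _ ≤ _ := by
        apply lintegral_mono_set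
        intro v hv
        exact lt_of_lt_of_le (by positivity) hv.1

lemma aux_fourier_shift (ψ : 𝓢(V, ℂ)) (a ξ : V) :
    𝓕 (ψ.compSubConstCLM ℂ a) ξ =
      ((Real.fourierChar (-inner ℝ a ξ) : Circle) : ℂ) * 𝓕 ψ ξ := by
  have := congrFun (VectorFourier.fourierIntegral_comp_add_right Real.fourierChar
    (volume : Measure V) (innerₗ V) (ψ : V → ℂ) (-a)) ξ
  rw [SchwartzMap.fourier_coe, SchwartzMap.fourier_coe]
  have h2 : ((ψ.compSubConstCLM ℂ a : 𝓢(V, ℂ)) : V → ℂ) = (ψ : V → ℂ) ∘ fun v => v + -a := by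
    ext v; simp [sub_eq_add_neg]
  rw [h2]
  refine this.trans ?_
  simp only [innerₗ_apply_apply, inner_neg_left]
  rfl

lemma aux_key (ψ : 𝓢(V, ℂ)) : ∃ C : ℝ, 0 < C ∧ ∀ (ι : Type) [Fintype ι] (x : ι → V) (w : ι → ℝ),
    ∫ z, ‖∑ i, (w i : ℂ) * ψ (z - x i)‖ ^ 2 ≤
      C * ∑ i, ∑ j, w i * w j * Real.exp (-dist (x i) (x j)) := by
  obtain ⟨c, hc, hlow⟩ := aux_lower_s11 (V := V)
  set n := Module.finrank ℝ V
  obtain ⟨B, hB, hdec⟩ : ∃ B : ℝ, 0 < B ∧ ∀ ξ, ‖𝓕 ψ ξ‖ ^ 2 ≤ B * ((1 + ‖ξ‖) ^ (n + 1))⁻¹ := by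
    set D := 2 ^ (n + 1) * (Finset.Iic (n + 1, 0)).sup (fun m => SchwartzMap.seminorm ℝ m.1 m.2) (𝓕 ψ)
    have hD : ∀ ξ, (1 + ‖ξ‖) ^ (n + 1) * ‖𝓕 ψ ξ‖ ≤ D := by
      intro ξ
      have := SchwartzMap.one_add_le_sup_seminorm_apply (𝕜 := ℝ) (m := (n + 1, 0)) (k := n + 1)
        (n := 0) le_rfl le_rfl (𝓕 ψ) ξ
      rwa [norm_iteratedFDeriv_zero] at this
    have hD0 : 0 ≤ D := le_trans (by positivity) (hD 0)
    refine ⟨D ^ 2 + 1, by positivity, fun ξ => ?_⟩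
    have hp : 1 ≤ (1 + ‖ξ‖) ^ (n + 1) := one_le_pow₀ (by linarith [norm_nonneg ξ])
    rw [← div_eq_mul_inv, le_div_iff₀ (by positivity)]
    have h3 : ‖𝓕 ψ ξ‖ ≤ D := by nlinarith [hD ξ, norm_nonneg (𝓕 ψ ξ)]
    nlinarith [hD ξ, norm_nonneg (𝓕 ψ ξ), mul_le_mul h3 (hD ξ) (by positivity) hD0]
  refine ⟨B / c, by positivity, ?_⟩
  intro ι _ x w
  set g : 𝓢(V, ℂ) := ∑ i, (w i : ℂ) • ψ.compSubConstCLM ℂ (x i) with hg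
  have hg1 : ∀ z, g z = ∑ i, (w i : ℂ) * ψ (z - x i) := by
    intro z
    simp [hg]
  have hg2 : ∀ ξ, 𝓕 g ξ = auxW x w ξ * 𝓕 ψ ξ := by
    intro ξ
    have : 𝓕 g = ∑ i, (w i : ℂ) • 𝓕 (ψ.compSubConstCLM ℂ (x i)) := by
      rw [← SchwartzMap.fourierTransformCLM_apply ℂ, hg, map_sum]
      simp
    rw [this, sum_apply, auxW, Finset.sum_mul]
    refine Finset.sum_congr rfl fun i _ => ?_
    rw [smul_apply, aux_fourier_shift, smul_eq_mul, mul_assoc]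
  simp_rw [← hg1]
  rw [← SchwartzMap.integral_norm_sq_fourier]
  simp_rw [hg2]
  rw [(aux_quad_subord x w).2]
  set Q := ∫ v in Set.Ioi (0:ℝ), (2 / √Real.pi * Real.exp (-v ^ 2)) *
        ∫ ξ, ‖auxW x w ξ‖ ^ 2 * auxG v ξ with hQ
  have hmeas : Measurable fun p : V × ℝ =>
      ENNReal.ofReal (2 / √Real.pi * Real.exp (-p.2 ^ 2) * (‖auxW x w p.1‖ ^ 2 * auxG p.2 p.1)) := by
    have := (auxW_continuous x w).measurable
    unfold auxG
    fun_prop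
  have hint : IntegrableOn (fun v => (2 / √Real.pi * Real.exp (-v ^ 2)) *
        ∫ ξ, ‖auxW x w ξ‖ ^ 2 * auxG v ξ) (Set.Ioi (0:ℝ)) :=
    (aux_quad_subord x w).1
  have hnn : ∀ v ∈ Set.Ioi (0:ℝ), 0 ≤ ∫ ξ, ‖auxW x w ξ‖ ^ 2 * auxG v ξ := fun v hv =>
    integral_nonneg fun ξ => mul_nonneg (by positivity) (auxG_nonneg (le_of_lt hv) ξ)
  have hQ0 : 0 ≤ Q := setIntegral_nonneg measurableSet_Ioi fun v hv =>
    mul_nonneg (by positivity) (hnn v hv)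
  have hQl : ENNReal.ofReal Q = ∫⁻ v in Set.Ioi (0:ℝ), ∫⁻ ξ,
      ENNReal.ofReal (2 / √Real.pi * Real.exp (-v ^ 2) * (‖auxW x w ξ‖ ^ 2 * auxG v ξ)) := by
    rw [hQ, ofReal_integral_eq_lintegral_ofReal hint]
    · apply setLIntegral_congr_fun measurableSet_Ioi
      intro v hv
      simp only
      rw [← integral_const_mul, ofReal_integral_eq_lintegral_ofReal]
      · exact (auxWG_integrable x w hv).const_mul _
      · exact ae_of_all _ fun ξ => mul_nonneg (by positivity)
          (mul_nonneg (by positivity) (auxG_nonneg (le_of_lt hv) ξ))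
    · filter_upwards [self_mem_ae_restrict measurableSet_Ioi] with v hv
      exact mul_nonneg (by positivity) (hnn v hv)
  rw [integral_eq_lintegral_of_nonneg_ae (ae_of_all _ fun ξ => by positivity)
    (by
      apply Continuous.aestronglyMeasurable
      exact (((auxW_continuous x w).mul (𝓕 ψ).continuous).norm.pow 2))]
  apply ENNReal.toReal_le_of_le_ofReal (by positivity)
  rw [ENNReal.ofReal_mul (by positivity), hQl, lintegral_lintegral_swap, ← lintegral_const_mul]
  · apply lintegral_mono
    intro ξ
    simp only
    have h1 : ∀ v ∈ Set.Ioi (0:ℝ), ENNReal.ofReal (2 / √Real.pi * Real.exp (-v ^ 2) * (‖auxW x w ξ‖ ^ 2 * auxG v ξ))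
      = ENNReal.ofReal (‖auxW x w ξ‖ ^ 2) * ENNReal.ofReal (2 / √Real.pi * Real.exp (-v ^ 2) * auxG v ξ) := by
      intro v hv
      rw [← ENNReal.ofReal_mul (by positivity)]
      congr 1
      ring
    rw [setLIntegral_congr_fun measurableSet_Ioi h1, lintegral_const_mul]
    · calc ENNReal.ofReal (‖auxW x w ξ * 𝓕 ψ ξ‖ ^ 2)
          ≤ ENNReal.ofReal (B / c * (‖auxW x w ξ‖ ^ 2 * (c * ((1 + ‖ξ‖) ^ (n + 1))⁻¹))) := by
            apply ENNReal.ofReal_le_ofReal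
            rw [norm_mul, mul_pow]
            calc _ ≤ ‖auxW x w ξ‖ ^ 2 * (B * ((1 + ‖ξ‖) ^ (n + 1))⁻¹) := by
                  gcongr; exact hdec ξ
              _ = _ := by field_simp
        _ = ENNReal.ofReal (B / c) * (ENNReal.ofReal (‖auxW x w ξ‖ ^ 2) *
              ENNReal.ofReal (c * ((1 + ‖ξ‖) ^ (n + 1))⁻¹)) := by
            rw [ENNReal.ofReal_mul (by positivity), ENNReal.ofReal_mul (by positivity)]
        _ ≤ _ := by gcongr; exact hlow ξ
    · unfold auxG; fun_prop
  · exact Measurable.lintegral_prod_right' (f := fun p : V × ℝ =>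
      ENNReal.ofReal (2 / √Real.pi * Real.exp (-p.2 ^ 2) * (‖auxW x w p.1‖ ^ 2 * auxG p.2 p.1))) hmeas
  · exact (hmeas.comp measurable_swap).aemeasurable

end

section
open MeasureTheory FourierTransform SchwartzMap
variable {V : Type*} [NormedAddCommGroup V] [InnerProductSpace ℝ V] [FiniteDimensional ℝ V]
    [MeasurableSpace V] [BorelSpace V]

lemma aux_bump {δ : ℝ} (hδ : 0 < δ) : ∃ C : ℝ, 0 < C ∧
    ∀ (ι : Type) [Fintype ι] (x : ι → V) (w : ι → ℝ) (A : Set V) (_ : MeasurableSet A)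
      (_ : volume A ≠ ⊤) (I : Finset ι) (_ : ∀ i ∈ I, closedBall (x i) δ ⊆ A)
      (_ : ∀ i, i ∉ I → Disjoint (closedBall (x i) δ) A),
    (∑ i ∈ I, w i) ^ 2 ≤ C * volume.real A *
      ∑ i, ∑ j, w i * w j * Real.exp (-dist (x i) (x j)) := by
  let f : ContDiffBump (0 : V) := ⟨δ / 2, δ, by positivity, by linarith⟩
  set φ : V → ℝ := f.normed volume with hφ
  have hsupp : ∀ z, z ∉ closedBall (0:V) δ → φ z = 0 := by
    intro z hz
    by_contra h
    have : z ∈ Function.support φ := h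
    rw [hφ, f.support_normed_eq] at this
    exact hz (ball_subset_closedBall this)
  have hcs : HasCompactSupport (fun z => (φ z : ℂ)) :=
    (f.hasCompactSupport_normed (μ := volume)).comp_left (g := fun r : ℝ => (r : ℂ)) (by simp)
  have hcd : ContDiff ℝ (⊤ : ℕ∞) (fun z => (φ z : ℂ)) :=
    Complex.ofRealCLM.contDiff.comp f.contDiff_normed
  obtain ⟨C, hC, hkey⟩ := aux_key (hcs.toSchwartzMap hcd)
  refine ⟨C, hC, ?_⟩
  intro ι _ x w A hA hAf I h1 h2
  have hk := hkey ι x w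
  set Q := ∑ i, ∑ j, w i * w j * Real.exp (-dist (x i) (x j))
  set g : V → ℝ := fun z => ∑ i, w i * φ (z - x i) with hg
  have hgC : ∀ z, ‖∑ i, (w i : ℂ) * (hcs.toSchwartzMap hcd) (z - x i)‖ ^ 2 = g z ^ 2 := by
    intro z
    have : ∑ i, (w i : ℂ) * (hcs.toSchwartzMap hcd) (z - x i) = (g z : ℂ) := by
      simp [hg]
    rw [this, Complex.norm_real, Real.norm_eq_abs, sq_abs]
  simp_rw [hgC] at hk
  have hφi : ∀ i, Integrable (fun z => w i * φ (z - x i)) := fun i =>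
    (f.integrable_normed.comp_sub_right (x i)).const_mul _
  have hφ2 : MemLp φ 2 volume :=
    f.continuous_normed.memLp_of_hasCompactSupport f.hasCompactSupport_normed
  have hg2 : MemLp g 2 volume := by
    refine memLp_finsetSum _ fun i _ => ?_
    exact (hφ2.comp_measurePreserving (measurePreserving_sub_right volume (x i))).const_mul _
  have hgi : Integrable g := integrable_finsetSum _ fun i _ => hφi i
  have hgs : Integrable (fun z => g z ^ 2) := hg2.integrable_sq
  have hgA : ∫ z in A, g z = ∑ i ∈ I, w i := by
    rw [hg, integral_finsetSum _ fun i _ => (hφi i).integrableOn, ← Finset.sum_subset (Finset.subset_univ I)]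
    · refine Finset.sum_congr rfl fun i hi => ?_
      rw [setIntegral_eq_integral_of_forall_compl_eq_zero, integral_const_mul,
        integral_sub_right_eq_self φ (x i), f.integral_normed, mul_one]
      intro z hz
      rw [hsupp, mul_zero]
      intro h
      apply hz
      apply h1 i hi
      simpa [dist_eq_norm] using h
    · intro i _ hi
      apply setIntegral_eq_zero_of_forall_eq_zero
      intro z hz
      rw [hsupp, mul_zero]
      intro h
      refine Set.disjoint_left.1 (h2 i hi) ?_ hz
      simpa [dist_eq_norm] using h
  have hle : ∫ z in A, g z ^ 2 ≤ C * Q :=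
    (setIntegral_le_integral hgs (ae_of_all _ fun z => sq_nonneg _)).trans hk
  have hquad : ∀ s : ℝ, 0 ≤ volume.real A * (s * s) + (-2 * ∫ z in A, g z) * s + C * Q := by
    intro s
    have h0 : 0 ≤ ∫ z in A, (g z - s) ^ 2 := integral_nonneg fun z => sq_nonneg _
    have h3 : ∫ z in A, (g z - s) ^ 2 =
        ∫ z in A, g z ^ 2 - (2 * s) * g z + s ^ 2 := by
      congr 1; ext z; ring
    have : IsFiniteMeasure (volume.restrict A) := ⟨by simpa using hAf.lt_top⟩
    rw [h3, integral_add, integral_sub, integral_const_mul] at h0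
    · simp at h0
      nlinarith
    · exact hgs.integrableOn
    · exact hgi.integrableOn.const_mul _
    · exact hgs.integrableOn.sub (hgi.integrableOn.const_mul _)
    · exact integrable_const _
  have := discrim_le_zero hquad
  rw [discrim, hgA] at this
  nlinarith

end

section
open MeasureTheory
variable {N : ℕ}
local notation "EE" => EuclideanSpace ℝ (Fin N)

/-- similarity matrix -/
noncomputable def auxZ {N : ℕ} (S : Finset (EuclideanSpace ℝ (Fin N))) : Matrix S S ℝ :=
  Matrix.of fun a b : S =>
      Real.exp (-dist (a : EuclideanSpace ℝ (Fin N)) (b : EuclideanSpace ℝ (Fin N)))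

/-- quadratic form -/
noncomputable def auxQ {N : ℕ} (S : Finset (EuclideanSpace ℝ (Fin N))) (w : S → ℝ) : ℝ :=
  ∑ i, ∑ j, w i * w j * Real.exp (-dist (i : EuclideanSpace ℝ (Fin N)) (j : EuclideanSpace ℝ (Fin N)))

lemma auxQ_eq (S : Finset EE) (w : S → ℝ) : auxQ S w = w ⬝ᵥ (auxZ S).mulVec w := by
  simp only [auxQ, auxZ, dotProduct, Matrix.mulVec, Matrix.of_apply, Finset.mul_sum]
  refine Finset.sum_congr rfl fun i _ => Finset.sum_congr rfl fun j _ => ?_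
  ring

lemma auxZ_symm (S : Finset EE) : (auxZ S).transpose = auxZ S := by
  ext i j; simp [auxZ, dist_comm]

lemma auxQ_nonneg (S : Finset EE) (w : S → ℝ) : 0 ≤ auxQ S w := by
  obtain ⟨C, hC, h⟩ := aux_key (V := EE) 0
  have := h S (fun i => (i : EE)) w
  have h2 := (integral_nonneg (fun z => by positivity)).trans this
  exact nonneg_of_mul_nonneg_right h2 hC

lemma auxZ_det (S : Finset EE) : (auxZ S).det ≠ 0 := by
  intro hdet
  obtain ⟨w, hw, hZ⟩ := Matrix.exists_mulVec_eq_zero_iff.2 hdet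
  apply hw
  have hQ : auxQ S w = 0 := by rw [auxQ_eq, hZ, dotProduct_zero]
  ext i
  have hop : IsOpen ((S.erase i : Finset EE) : Set EE)ᶜ :=
    (Finset.finite_toSet _).isClosed.isOpen_compl
  obtain ⟨ε, hε, hball⟩ := Metric.isOpen_iff.1 hop (i : EE) (by simp)
  obtain ⟨C, hC, h⟩ := aux_bump (V := EE) (δ := ε / 3) (by positivity)
  have := h S (fun i => (i : EE)) w (closedBall (i : EE) (ε / 3)) measurableSet_closedBall
    measure_closedBall_lt_top.ne {i} (by simp) (by
      intro j hj
      rw [Set.disjoint_left]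
      intro z hz1 hz2
      have hji : (j : EE) ∈ (S.erase i : Finset EE) := by
        simp only [Finset.mem_singleton] at hj
        simpa using fun h => hj h
      refine hball ?_ (Finset.mem_coe.2 hji)
      rw [mem_ball]
      rw [mem_closedBall] at hz1 hz2
      have := dist_triangle_left (j : EE) i z
      linarith)
  change _ ≤ _ * auxQ S w at this
  rw [hQ, mul_zero, Finset.sum_singleton] at this
  simpa using pow_eq_zero_iff (two_ne_zero) |>.1 (le_antisymm this (sq_nonneg _))

lemma aux_weight (S : Finset EE) : ∃ w : S → ℝ, (auxZ S).mulVec w = (fun _ => 1) ∧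
    finMagnitude S = ∑ i, w i := by
  refine ⟨(auxZ S)⁻¹.mulVec (fun _ => 1), ?_, ?_⟩
  · rw [Matrix.mulVec_mulVec, Matrix.mul_nonsing_inv _ (isUnit_iff_ne_zero.2 (auxZ_det S)),
      Matrix.one_mulVec]
  · unfold finMagnitude
    refine Finset.sum_congr rfl fun i _ => ?_
    simp only [Matrix.mulVec, dotProduct, mul_one]
    rfl

lemma aux_upper_s11 : ∃ C : ℝ, 0 < C ∧ ∀ S T : Finset EE,
    (∀ x ∈ S, ∃ c ∈ T, dist x c ≤ 1) → finMagnitude S ≤ C * T.card := by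
  obtain ⟨C, hC, h⟩ := aux_bump (V := EE) (δ := 1) one_pos
  refine ⟨C * volume.real (closedBall (0 : EE) 2), ?_, ?_⟩
  · apply mul_pos hC
    apply ENNReal.toReal_pos (measure_closedBall_pos _ _ (by norm_num)).ne'
      measure_closedBall_lt_top.ne
  intro S T hST
  obtain ⟨w, hw, hm⟩ := aux_weight S
  have hb := h S (fun i => (i : EE)) w (⋃ c ∈ T, closedBall c 2)
    (Finset.measurableSet_biUnion _ fun _ _ => measurableSet_closedBall)
    ((measure_biUnion_lt_top T.finite_toSet fun _ _ => measure_closedBall_lt_top).ne)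
    Finset.univ (by
      intro i _
      obtain ⟨c, hc, hic⟩ := hST i i.2
      refine Set.Subset.trans ?_ (Set.subset_biUnion_of_mem (u := fun c => closedBall c 2) hc)
      apply closedBall_subset_closedBall'
      linarith) (by simp)
  change _ ≤ _ * auxQ S w at hb
  have hQ : auxQ S w = finMagnitude S := by
    rw [auxQ_eq, hw, hm]; simp [dotProduct]
  have hv : volume.real (⋃ c ∈ T, closedBall c 2) ≤ T.card * volume.real (closedBall (0 : EE) 2) := by
    refine (measureReal_biUnion_finset_le _ _).trans ?_
    rw [← nsmul_eq_mul, ← Finset.sum_const]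
    refine (Finset.sum_le_sum fun c _ => le_of_eq ?_)
    rw [Measure.real, Measure.addHaar_closedBall_center]; rfl
  rw [hQ, ← hm] at hb
  have hm0 : 0 ≤ finMagnitude S := hQ ▸ auxQ_nonneg S w
  rcases hm0.eq_or_lt with h0 | h0
  · rw [← h0]; positivity
  · have : finMagnitude S ≤ C * volume.real (⋃ c ∈ T, closedBall c 2) := by
      rw [pow_two] at hb
      exact le_of_mul_le_mul_right hb h0
    calc _ ≤ _ := this
      _ ≤ C * (T.card * volume.real (closedBall (0 : EE) 2)) := by gcongr
      _ = _ := by ring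

lemma aux_exp_int : Integrable (fun z : EE => Real.exp (-‖z‖)) := by
  have h1 := integrable_one_add_norm (E := EE) (μ := volume)
    (r := (Module.finrank ℝ EE : ℝ) + 1) (by linarith)
  set n := Module.finrank ℝ EE
  refine (h1.const_mul (((n + 1).factorial : ℝ) * Real.exp 1)).mono' ?_ (ae_of_all _ fun z => ?_)
  · apply Continuous.aestronglyMeasurable; fun_prop
  · rw [Real.norm_of_nonneg (Real.exp_pos _).le, Real.rpow_neg (by positivity)]
    have h2 := Real.pow_div_factorial_le_exp (1 + ‖z‖) (by positivity) (n + 1)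
    have h3 : (1 + ‖z‖) ^ ((n : ℝ) + 1) = (1 + ‖z‖) ^ (n + 1) := by
      rw [← Real.rpow_natCast]; push_cast; rfl
    rw [h3, ← div_eq_mul_inv, le_div_iff₀ (by positivity)]
    rw [div_le_iff₀ (by positivity)] at h2
    calc _ ≤ Real.exp (-‖z‖) * (Real.exp (1 + ‖z‖) * (n + 1).factorial) := by gcongr
      _ = (Real.exp (-‖z‖) * Real.exp (1 + ‖z‖)) * (n + 1).factorial := by ring
      _ = _ := by rw [← Real.exp_add, mul_comm]; congr 2; ring

lemma aux_sum_exp : ∃ C : ℝ, 0 < C ∧ ∀ (S : Finset EE) (x : EE),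
    (∀ a ∈ S, ∀ b ∈ S, a ≠ b → 1 ≤ dist a b) →
    ∑ y ∈ S, Real.exp (-dist x y) ≤ C := by
  set b := volume.real (ball (0 : EE) (1 / 2))
  have hb : 0 < b := ENNReal.toReal_pos (measure_ball_pos _ _ (by norm_num)).ne' measure_ball_lt_top.ne
  have hI : 0 ≤ ∫ z : EE, Real.exp (-‖z‖) := integral_nonneg fun z => (Real.exp_pos _).le
  refine ⟨Real.exp (1 / 2) * (∫ z : EE, Real.exp (-‖z‖)) / b + 1, by positivity, ?_⟩
  intro S x hS
  have hint : Integrable (fun z : EE => Real.exp (-‖z - x‖)) := aux_exp_int.comp_sub_right x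
  have h1 : ∀ y ∈ S, b * Real.exp (-dist x y) ≤
      Real.exp (1 / 2) * ∫ z in ball y (1 / 2), Real.exp (-‖z - x‖) := by
    intro y _
    have hc : b * Real.exp (-dist x y) = ∫ z in ball y (1 / 2), Real.exp (-dist x y) := by
      rw [setIntegral_const, smul_eq_mul]
      congr 1
      rw [Measure.real, Measure.addHaar_ball_center]; rfl
    rw [hc, ← integral_const_mul]
    refine setIntegral_mono_on ?_ ?_ measurableSet_ball ?_
    · exact integrableOn_const (measure_ball_lt_top.ne)
    · exact (hint.const_mul _).integrableOn
    · intro z hz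
      rw [← Real.exp_add]
      apply Real.exp_le_exp.2
      rw [mem_ball] at hz
      have := dist_triangle x y z
      have := dist_triangle_right z x y
      rw [← dist_eq_norm]
      rw [dist_comm x y] at *
      linarith [dist_comm x y]
  have h2 : ∑ y ∈ S, ∫ z in ball y (1 / 2), Real.exp (-‖z - x‖) ≤ ∫ z : EE, Real.exp (-‖z‖) := by
    rw [← integral_biUnion_finset S (fun _ _ => measurableSet_ball) ?_
      (fun _ _ => hint.integrableOn)]
    · refine (setIntegral_le_integral hint (ae_of_all _ fun z => (Real.exp_pos _).le)).trans ?_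
      rw [integral_sub_right_eq_self (fun z : EE => Real.exp (-‖z‖)) x]
    · intro a ha c hc hac
      apply ball_disjoint_ball
      have := hS a ha c hc hac
      linarith
  have h3 : b * ∑ y ∈ S, Real.exp (-dist x y) ≤ Real.exp (1 / 2) * ∫ z : EE, Real.exp (-‖z‖) := by
    rw [Finset.mul_sum]
    refine (Finset.sum_le_sum h1).trans ?_
    rw [← Finset.mul_sum]
    gcongr
  rw [← le_div_iff₀' hb] at h3
  linarith

lemma aux_lowerM : ∃ c : ℝ, 0 < c ∧ ∀ S : Finset EE,
    (∀ a ∈ S, ∀ b ∈ S, a ≠ b → 1 ≤ dist a b) → c * S.card ≤ finMagnitude S := by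
  obtain ⟨C, hC, h⟩ := aux_sum_exp (N := N)
  refine ⟨C⁻¹, by positivity, ?_⟩
  intro S hS
  obtain ⟨w, hw, hm⟩ := aux_weight S
  have h0 := auxQ_nonneg S ((fun _ => 1) - C • w)
  have h1 : auxQ S (fun _ => 1) ≤ C * S.card := by
    unfold auxQ
    have : ∀ i : S, ∑ j : S, (1:ℝ) * 1 * Real.exp (-dist (i : EE) (j : EE)) ≤ C := by
      intro i
      have := h S i hS
      rw [← Finset.sum_coe_sort] at this
      simpa using this
    refine (Finset.sum_le_sum fun i _ => this i).trans ?_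
    simp [mul_comm]
  have h2 : (w ⬝ᵥ (auxZ S).mulVec fun _ => 1) = S.card := by
    rw [Matrix.dotProduct_mulVec, ← Matrix.mulVec_transpose, auxZ_symm, hw]
    simp [dotProduct]
  rw [auxQ_eq] at h0 h1
  rw [Matrix.mulVec_sub, Matrix.mulVec_smul, sub_dotProduct, dotProduct_sub, dotProduct_sub,
    smul_dotProduct, smul_dotProduct, dotProduct_smul, dotProduct_smul, hw, h2] at h0
  have h3 : (w ⬝ᵥ fun _ => (1:ℝ)) = finMagnitude S := by rw [hm]; simp [dotProduct]
  have h4 : ((fun _ : S => (1:ℝ)) ⬝ᵥ fun _ => (1:ℝ)) = S.card := by simp [dotProduct]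
  rw [h3, h4] at h0
  simp only [smul_eq_mul] at h0
  rw [inv_mul_le_iff₀ hC]
  have h5 : 0 ≤ C * (C * finMagnitude S - S.card) := by nlinarith
  have := nonneg_of_mul_nonneg_right h5 hC
  linarith

end

lemma aux_limsup_le {u v : ℝ → ℝ} (h : Tendsto (fun t => u t - v t) atTop (nhds 0))
    (hu : ∀ᶠ t in atTop, -1 ≤ u t) (hne : {a | ∀ᶠ t in atTop, v t ≤ a}.Nonempty) :
    limsup u atTop ≤ limsup v atTop := by
  rw [limsup_eq, limsup_eq]
  refine le_csInf hne fun a ha => ?_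
  refine le_of_forall_pos_le_add fun ε hε => ?_
  apply csInf_le
  · refine ⟨-1, fun b hb => ?_⟩
    obtain ⟨t, h1, h2⟩ := (hu.and hb).exists
    exact h1.trans h2
  · have h3 : ∀ᶠ t in atTop, u t - v t < ε := h.eventually (gt_mem_nhds hε)
    have ha : ∀ᶠ t in atTop, v t ≤ a := ha
    show ∀ᶠ t in atTop, u t ≤ a + ε
    filter_upwards [h3, ha] with t h4 h5
    linarith

lemma aux_limsup_eq {u v : ℝ → ℝ} (h : Tendsto (fun t => u t - v t) atTop (nhds 0))
    (hv : ∀ᶠ t in atTop, 0 ≤ v t) :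
    limsup u atTop = limsup v atTop := by
  have hu : ∀ᶠ t in atTop, -1 ≤ u t := by
    have h3 : ∀ᶠ t in atTop, -1 < u t - v t := h.eventually (lt_mem_nhds (by norm_num))
    filter_upwards [h3, hv] with t h4 h5
    linarith
  have hv' : ∀ᶠ t in atTop, -1 ≤ v t := hv.mono fun t ht => by linarith
  have h' : Tendsto (fun t => v t - u t) atTop (nhds 0) := by
    simpa using h.neg
  have key : ∀ {p q : ℝ → ℝ}, Tendsto (fun t => p t - q t) atTop (nhds 0) →
      {a | ∀ᶠ t in atTop, p t ≤ a}.Nonempty → {a | ∀ᶠ t in atTop, q t ≤ a}.Nonempty := by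
    rintro p q hpq ⟨a, ha⟩
    refine ⟨a + 1, ?_⟩
    have ha : ∀ᶠ t in atTop, p t ≤ a := ha
    have h3 : ∀ᶠ t in atTop, -1 < p t - q t := hpq.eventually (lt_mem_nhds (by norm_num))
    show ∀ᶠ t in atTop, q t ≤ a + 1
    filter_upwards [h3, ha] with t h4 h5
    linarith
  by_cases hne : {a | ∀ᶠ t in atTop, v t ≤ a}.Nonempty
  · exact le_antisymm (aux_limsup_le h hu hne) (aux_limsup_le h' hv' (key h' hne))
  · have hne' : ¬ {a | ∀ᶠ t in atTop, u t ≤ a}.Nonempty := fun h2 => hne (key h h2)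
    rw [Set.not_nonempty_iff_eq_empty] at hne hne'
    rw [limsup_eq, limsup_eq, hne, hne']

lemma aux_cover {N : ℕ} {X : Set (EuclideanSpace ℝ (Fin N))} (hX : IsCompact X) {ε : ℝ}
    (hε : 0 < ε) : ∃ t : Finset (EuclideanSpace ℝ (Fin N)), ↑t ⊆ X ∧
      t.card = setCoveringNumber X ε ∧ ∀ x ∈ X, ∃ c ∈ t, dist x c ≤ ε := by
  obtain ⟨t, h1, h2, h3⟩ := hX.finite_cover_balls hε
  have : {n : ℕ | ∃ t : Finset (EuclideanSpace ℝ (Fin N)), ↑t ⊆ X ∧ t.card = n ∧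
      ∀ x ∈ X, ∃ c ∈ t, dist x c ≤ ε}.Nonempty := by
    refine ⟨_, h2.toFinset, by simpa using h1, rfl, fun x hx => ?_⟩
    obtain ⟨c, hc, hxc⟩ := Set.mem_iUnion₂.1 (h3 hx)
    exact ⟨c, by simpa using hc, (mem_ball.1 hxc).le⟩
  exact Nat.sInf_mem this

lemma aux_main {N : ℕ} {X : Set (EuclideanSpace ℝ (Fin N))} (hXne : X.Nonempty)
    (hX : IsCompact X) : ∃ c C : ℝ, 0 < c ∧ 0 < C ∧ ∀ t : ℝ, 0 < t →
      1 ≤ setCoveringNumber X t⁻¹ ∧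
      c * setCoveringNumber X t⁻¹ ≤ magnitude ((fun x => t • x) '' X) ∧
      magnitude ((fun x => t • x) '' X) ≤ C * setCoveringNumber X t⁻¹ := by
  obtain ⟨C, hC, hup⟩ := aux_upper_s11 (N := N)
  obtain ⟨c, hc, hlo⟩ := aux_lowerM (N := N)
  refine ⟨c, C, hc, hC, ?_⟩
  intro t ht
  have hdist : ∀ x y : EuclideanSpace ℝ (Fin N), dist (t • x) (t • y) = t * dist x y := by
    intro x y; rw [dist_smul₀, Real.norm_of_nonneg ht.le]
  have hinj : Function.Injective (fun x : EuclideanSpace ℝ (Fin N) => t • x) :=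
    smul_right_injective _ ht.ne'
  obtain ⟨T, hTX, hTc, hT⟩ := aux_cover hX (inv_pos.2 ht)
  obtain ⟨x0, hx0⟩ := hXne
  have hS : ∀ S : Finset (EuclideanSpace ℝ (Fin N)), ↑S ⊆ (fun x => t • x) '' X →
      finMagnitude S ≤ C * setCoveringNumber X t⁻¹ := by
    intro S hSX
    refine (hup S (T.image fun x => t • x) ?_).trans ?_
    · intro y hy
      obtain ⟨x, hx, rfl⟩ := hSX hy
      obtain ⟨c, hc, hxc⟩ := hT x hx
      refine ⟨t • c, Finset.mem_image_of_mem _ hc, ?_⟩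
      simp only
      rw [hdist]
      calc t * dist x c ≤ t * t⁻¹ := by gcongr
        _ = 1 := mul_inv_cancel₀ ht.ne'
    · rw [← hTc]
      have hcard : (T.image fun x => t • x).card ≤ T.card := Finset.card_image_le
      gcongr
  refine ⟨?_, ?_, ?_⟩
  · rw [← hTc]
    obtain ⟨c, hc, _⟩ := hT x0 hx0
    exact Finset.card_pos.2 ⟨c, hc⟩
  · have hmag : ∀ S : Finset (EuclideanSpace ℝ (Fin N)), S.Nonempty → ↑S ⊆ X →
        (∀ a ∈ S, ∀ b ∈ S, a ≠ b → t⁻¹ < dist a b) →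
        finMagnitude (S.image fun x => t • x) ≤ C * setCoveringNumber X t⁻¹ ∧
        c * S.card ≤ finMagnitude (S.image fun x => t • x) ∧
        c * S.card ≤ magnitude ((fun x => t • x) '' X) := by
      intro S hSne hSX hsep
      have hsub : ↑(S.image fun x => t • x) ⊆ (fun x => t • x) '' X := by
        rw [Finset.coe_image]; exact Set.image_mono hSX
      have h1 : c * S.card ≤ finMagnitude (S.image fun x => t • x) := by
        have := hlo (S.image fun x => t • x) (by
          intro a ha b hb hab
          obtain ⟨a, ha', rfl⟩ := Finset.mem_image.1 ha
          obtain ⟨b, hb', rfl⟩ := Finset.mem_image.1 hb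
          rw [hdist]
          have := hsep a ha' b hb' (fun h => hab (by rw [h]))
          calc 1 = t * t⁻¹ := (mul_inv_cancel₀ ht.ne').symm
            _ ≤ _ := by gcongr)
        rwa [Finset.card_image_of_injective _ hinj] at this
      refine ⟨hS _ hsub, h1, h1.trans ?_⟩
      refine le_csSup ⟨C * setCoveringNumber X t⁻¹, ?_⟩ ⟨_, hSne.image _, hsub, rfl⟩
      rintro m ⟨S, -, hS2, rfl⟩
      exact hS S hS2
    let P : ℕ → Prop := fun k => ∃ S : Finset (EuclideanSpace ℝ (Fin N)), S.Nonempty ∧ ↑S ⊆ X ∧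
        (∀ a ∈ S, ∀ b ∈ S, a ≠ b → t⁻¹ < dist a b) ∧ S.card = k
    obtain ⟨M, hM⟩ : ∃ M : ℕ, ∀ k, P k → k ≤ M := by
      obtain ⟨M, hM⟩ := exists_nat_ge (C * setCoveringNumber X t⁻¹ / c)
      refine ⟨M, ?_⟩
      rintro k ⟨S, h1, h2, h3, rfl⟩
      have := hmag S h1 h2 h3
      have h4 : (S.card : ℝ) ≤ C * setCoveringNumber X t⁻¹ / c := by
        rw [le_div_iff₀' hc]; linarith
      exact_mod_cast h4.trans hM
    have hP1 : P 1 := ⟨{x0}, by simp, by simpa using hx0, by simp, by simp⟩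
    obtain ⟨S, h1, h2, h3, h4⟩ := Nat.findGreatest_spec (P := P) (hM 1 hP1) hP1
    refine le_trans ?_ (hmag S h1 h2 h3).2.2
    gcongr
    apply Nat.sInf_le
    by_contra hcon
    have : ¬ ∀ x ∈ X, ∃ c ∈ S, dist x c ≤ t⁻¹ := fun h => hcon ⟨S, h2, rfl, h⟩
    push Not at this
    obtain ⟨x, hx, hxS⟩ := this
    have hxn : x ∉ S := fun h => by
      have := hxS x h
      rw [dist_self] at this
      exact absurd this (not_lt.2 (inv_pos.2 ht).le)
    have hP : P (S.card + 1) := by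
      refine ⟨insert x S, by simp, ?_, ?_, Finset.card_insert_of_notMem hxn⟩
      · rw [Finset.coe_insert]; exact Set.insert_subset hx h2
      · intro a ha b hb hab
        rw [Finset.mem_insert] at ha hb
        rcases ha with rfl | ha <;> rcases hb with rfl | hb
        · exact absurd rfl hab
        · exact hxS b hb
        · rw [dist_comm]; exact hxS a ha
        · exact h3 a ha b hb hab
    have := Nat.le_findGreatest (hM _ hP) hP
    omega
  · apply csSup_le
    · exact ⟨_, {t • x0}, by simp, by simpa using ⟨x0, hx0, rfl⟩, rfl⟩
    · rintro m ⟨S, -, hS2, rfl⟩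
      exact hS S hS2

/-- **Meckes**: for a nonempty compact set `X ⊆ ℝ^N` the upper magnitude dimension
`limsup_{t→∞} log |tX| / log t` equals the upper box-counting dimension
`limsup_{ε→0⁺} log N(X, ε) / log (1/ε)`. -/
theorem upperMagnitudeDim_eq_upperBoxDim (N : ℕ) (X : Set (EuclideanSpace ℝ (Fin N)))
    (hXne : X.Nonempty) (hX : IsCompact X) :
    limsup (fun t : ℝ => Real.log (magnitude ((fun x => t • x) '' X)) / Real.log t) atTop =
      limsup (fun ε : ℝ => Real.log (setCoveringNumber X ε) / Real.log (1 / ε))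
        (nhdsWithin 0 (Set.Ioi 0)) := by
  obtain ⟨c, C, hc, hC, h⟩ := aux_main hXne hX
  have hR : limsup (fun ε : ℝ => Real.log (setCoveringNumber X ε) / Real.log (1 / ε))
        (nhdsWithin 0 (Set.Ioi 0)) =
      limsup (fun t : ℝ => Real.log (setCoveringNumber X t⁻¹) / Real.log t) atTop := by
    rw [← inv_atTop₀, ← Filter.map_inv, limsup, limsup, Filter.map_map]
    congr 2
    ext t
    simp
  rw [hR]
  apply aux_limsup_eq
  · have hlog : Tendsto (fun t : ℝ => (|Real.log c| + |Real.log C|) / Real.log t) atTop (nhds 0) :=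
      tendsto_const_nhds.div_atTop Real.tendsto_log_atTop
    refine squeeze_zero_norm' ?_ hlog
    filter_upwards [eventually_gt_atTop 1] with t ht
    obtain ⟨h1, h2, h3⟩ := h t (by linarith)
    have hl : 0 < Real.log t := Real.log_pos ht
    have hn : (0:ℝ) < setCoveringNumber X t⁻¹ := by exact_mod_cast h1
    have hM : 0 < magnitude ((fun x => t • x) '' X) := lt_of_lt_of_le (by positivity) h2
    rw [← sub_div, norm_div, Real.norm_of_nonneg hl.le, Real.norm_eq_abs]
    gcongr
    have e1 := Real.log_le_log (by positivity) h2
    have e2 := Real.log_le_log hM h3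
    rw [Real.log_mul hc.ne' hn.ne'] at e1
    rw [Real.log_mul hC.ne' hn.ne'] at e2
    rw [abs_le]
    constructor <;> linarith [neg_abs_le (Real.log c), le_abs_self (Real.log C),
      abs_nonneg (Real.log c), abs_nonneg (Real.log C)]
  · filter_upwards [eventually_gt_atTop 1] with t ht
    obtain ⟨h1, h2, h3⟩ := h t (by linarith)
    have hl : 0 < Real.log t := Real.log_pos ht
    apply div_nonneg _ hl.le
    apply Real.log_nonneg
    exact_mod_cast h1
end

section
/- Let k ≥ 4 be an integer and d > 0, and let S be a real random variable with the Gamma distribution with shape parameter k−1 and rate d, i.e. with density s ↦ d^{k−1} s^{k−2} e^{−ds} / Γ(k−1) on (0, ∞). Then E[(k−2)/S] = d and Var[(k−2)/S] = d²/(k−3). -/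
open MeasureTheory ProbabilityTheory

lemma gamma_inv_moment (a r : ℝ) (n : ℕ) (ha : (n : ℝ) < a) (hr : 0 < r) :
    ∫ x, (x ^ n)⁻¹ ∂(gammaMeasure a r) = r ^ n * Real.Gamma (a - n) / Real.Gamma a := by
  have ha0 : 0 < a := lt_of_le_of_lt (Nat.cast_nonneg n) ha
  have h1 : ∫ x, (x ^ n)⁻¹ ∂(gammaMeasure a r) = ∫ x, gammaPDFReal a r x * (x ^ n)⁻¹ := by
    rw [gammaMeasure, integral_withDensity_eq_integral_toReal_smul]
    · refine integral_congr_ae (Filter.Eventually.of_forall fun x => ?_)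
      simp [gammaPDF, ENNReal.toReal_ofReal (gammaPDFReal_nonneg ha0 hr x)]
    · exact (measurable_gammaPDFReal a r).ennreal_ofReal
    · exact Filter.Eventually.of_forall fun x => ENNReal.ofReal_lt_top
  have h2 : ∫ x, gammaPDFReal a r x * (x ^ n)⁻¹
      = ∫ x in Set.Ici (0:ℝ), gammaPDFReal a r x * (x ^ n)⁻¹ := by
    symm
    apply setIntegral_eq_integral_of_forall_compl_eq_zero
    intro x hx
    have : ¬ (0 ≤ x) := hx
    simp [gammaPDFReal, this]
  rw [h1, h2, integral_Ici_eq_integral_Ioi]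
  have h3 : ∫ x in Set.Ioi (0:ℝ), gammaPDFReal a r x * (x ^ n)⁻¹
      = ∫ x in Set.Ioi (0:ℝ), (r ^ a / Real.Gamma a) *
        (x ^ ((a - n) - 1) * Real.exp (-(r * x))) := by
    refine setIntegral_congr_fun measurableSet_Ioi fun x hx => ?_
    have hx' : 0 < x := hx
    have e : x ^ ((a - n) - 1) = x ^ (a - 1) * (x ^ n)⁻¹ := by
      rw [show a - n - 1 = (a - 1) - n by ring, Real.rpow_sub hx', Real.rpow_natCast,
        div_eq_mul_inv]
    simp only [gammaPDFReal, if_pos hx'.le, e]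
    ring
  rw [h3, integral_const_mul, Real.integral_rpow_mul_exp_neg_mul_Ioi (by linarith) hr,
    Real.div_rpow zero_le_one hr.le, Real.one_rpow, Real.rpow_sub hr, Real.rpow_natCast]
  have := (Real.rpow_pos_of_pos hr a).ne'
  have := (Real.Gamma_pos_of_pos ha0).ne'
  field_simp

/-- If `k ≥ 4` and `S` has the Gamma distribution with shape `k − 1` and rate `d > 0`
(density `s ↦ d^(k−1) s^(k−2) e^(−d s) / Γ(k−1)` on `(0, ∞)`), then `(k−2)/S` has
expectation `d` and variance `d²/(k−3)`. -/
theorem gamma_mle_unbiased (k : ℕ) (hk : 4 ≤ k) (d : ℝ) (hd : 0 < d)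
    (Ω : Type*) [MeasurableSpace Ω] (P : Measure Ω) [IsProbabilityMeasure P]
    (S : Ω → ℝ) (hS : Measurable S)
    (hlaw : Measure.map S P = gammaMeasure ((k : ℝ) - 1) d) :
    (∫ ω, ((k : ℝ) - 2) / S ω ∂P) = d ∧
      variance (fun ω => ((k : ℝ) - 2) / S ω) P = d ^ 2 / ((k : ℝ) - 3) := by
  have hk' : (4 : ℝ) ≤ k := by exact_mod_cast hk
  have hG2 : Real.Gamma ((k : ℝ) - 1) = (k - 2) * Real.Gamma ((k : ℝ) - 2) := by
    rw [← Real.Gamma_add_one (by linarith)]; ring_nf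
  have hG3 : Real.Gamma ((k : ℝ) - 2) = (k - 3) * Real.Gamma ((k : ℝ) - 3) := by
    rw [← Real.Gamma_add_one (by linarith)]; ring_nf
  have hp := Real.Gamma_pos_of_pos (show 0 < (k : ℝ) - 3 by linarith)
  have p3 : (k : ℝ) - 3 ≠ 0 := by linarith
  have p2 : (k : ℝ) - 2 ≠ 0 := by linarith
  have hmom : ∀ n : ℕ, ∫ ω, (S ω ^ n)⁻¹ ∂P
      = ∫ x, (x ^ n)⁻¹ ∂(gammaMeasure ((k : ℝ) - 1) d) := by
    intro n
    rw [← hlaw, integral_map hS.aemeasurable]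
    exact (by fun_prop : Measurable fun x : ℝ => (x ^ n)⁻¹).aestronglyMeasurable
  have m1 : (∫ ω, ((k : ℝ) - 2) / S ω ∂P) = d := by
    have := hmom 1
    rw [gamma_inv_moment _ _ _ (by push_cast; linarith) hd] at this
    simp only [pow_one, Nat.cast_one] at this
    simp_rw [div_eq_mul_inv]
    rw [integral_const_mul, this, show (k : ℝ) - 1 - 1 = k - 2 by ring, hG2, hG3]
    field_simp
  have m2 : (∫ ω, (((k : ℝ) - 2) / S ω) ^ 2 ∂P) = d ^ 2 * (k - 2) / (k - 3) := by
    have := hmom 2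
    rw [gamma_inv_moment _ _ _ (by push_cast; linarith) hd] at this
    simp only [Nat.cast_ofNat] at this
    simp_rw [div_pow, div_eq_mul_inv]
    rw [integral_const_mul, this, show (k : ℝ) - 1 - 2 = k - 3 by ring, hG2, hG3]
    field_simp
  refine ⟨m1, ?_⟩
  have hint : Integrable (fun ω => (((k : ℝ) - 2) / S ω) ^ 2) P := by
    apply Integrable.of_integral_ne_zero
    rw [m2]
    positivity
  have hL : MemLp (fun ω => ((k : ℝ) - 2) / S ω) 2 P :=
    (memLp_two_iff_integrable_sq (hS.const_div _).aestronglyMeasurable).2 hint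
  rw [variance_eq_sub hL, m1]
  simp only [Pi.pow_apply]
  rw [m2]
  field_simp
  ring
end
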